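/- arXiv:2101.06496 — 2 statements merged into one kernel-verified Lean document; each statement's English description precedes it below -/
import Mathlib

section
/- Let K be a field, m < n positive integers, and f = (∏_{k=0}^{m-2} det(X_{[1,k+1]}^{[m-k,m]}) · det(X_{[n-k,n]}^{[1,k+1]})) · ∏_{k=1}^{n-m+1} det(X_{[k,m+k-1]}) in S = K[x_{ij}]. Then for every t with 1 ≤ t ≤ m and all row indices 1 ≤ a < b ≤ m with b − a + 1 ≥ t, the ideal I_t(X^{[a,b]}) generated by the t×t minors of the submatrix of X on rows a,...,b belongs to C_f. -/
/-- The ideal of `t × t` minors of the generic `m × n` matrix `X` (with entries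
`X i j = MvPolynomial.X (i, j)`), using only rows with 1-based index in `[r1, r2]`
and columns with 1-based index in `[c1, c2]`. -/
noncomputable def genMinors (K : Type*) [Field K] (m n : ℕ) (t : ℕ) (r1 r2 c1 c2 : ℕ) :
    Ideal (MvPolynomial (Fin m × Fin n) K) :=
  Ideal.span { p | ∃ (r : Fin t → Fin m) (c : Fin t → Fin n),
    StrictMono r ∧ StrictMono c ∧
    (∀ i, r1 ≤ (r i).val + 1 ∧ (r i).val + 1 ≤ r2) ∧
    (∀ j, c1 ≤ (c j).val + 1 ∧ (c j).val + 1 ≤ c2) ∧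
    p = Matrix.det (Matrix.of fun i j => MvPolynomial.X (r i, c j)) }

/-- The polynomial
`f = (∏_{k=0}^{m-2} det X_{[1,k+1]}^{[m-k,m]} ⬝ det X_{[n-k,n]}^{[1,k+1]}) ⬝ ∏_{k=1}^{n-m+1} det X_{[k,m+k-1]}`
(1-based intervals, subscripts = columns, superscripts = rows). -/
noncomputable def knutsonF (K : Type*) [Field K] (m n : ℕ) (hm : 0 < m) (hmn : m < n) :
    MvPolynomial (Fin m × Fin n) K :=
  (∏ k : Fin (m - 1),
      (Matrix.det (Matrix.of fun (i j : Fin (k.val + 1)) =>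
        MvPolynomial.X ((⟨m - 1 - k.val + i.val, by omega⟩ : Fin m),
                        (⟨j.val, by omega⟩ : Fin n)))
      * Matrix.det (Matrix.of fun (i j : Fin (k.val + 1)) =>
        MvPolynomial.X ((⟨i.val, by omega⟩ : Fin m),
                        (⟨n - 1 - k.val + j.val, by omega⟩ : Fin n)))))
  * ∏ k : Fin (n - m + 1),
      Matrix.det (Matrix.of fun (i j : Fin m) =>
        MvPolynomial.X ((⟨i.val, i.isLt⟩ : Fin m), (⟨k.val + j.val, by omega⟩ : Fin n)))

/-- The family of Knutson ideals `C_f`: the smallest set of ideals containing `(f)`,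
closed under colon ideals by arbitrary ideals, and under sums and intersections. -/
inductive IsKnutson {K : Type*} [Field K] {m n : ℕ}
    (f : MvPolynomial (Fin m × Fin n) K) : Ideal (MvPolynomial (Fin m × Fin n) K) → Prop
  | base : IsKnutson f (Ideal.span {f})
  | colon (I J : Ideal (MvPolynomial (Fin m × Fin n) K)) :
      IsKnutson f I → IsKnutson f (I.colon J)
  | add (I J : Ideal (MvPolynomial (Fin m × Fin n) K)) :
      IsKnutson f I → IsKnutson f J → IsKnutson f (I + J)
  | inf (I J : Ideal (MvPolynomial (Fin m × Fin n) K)) :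
      IsKnutson f I → IsKnutson f J → IsKnutson f (I ⊓ J)


section KnutsonAux

open Matrix

def MV {ρ κ R : Type*} [CommRing R] (M : Matrix ρ κ R) (t : ℕ) (A : Set ρ) (B : Set κ) : Prop :=
  ∀ (r : Fin t → ρ) (c : Fin t → κ), (∀ i, r i ∈ A) → (∀ j, c j ∈ B) → (M.submatrix r c).det = 0

section MVsec
variable {ρ κ R : Type*} [CommRing R] {M : Matrix ρ κ R}

lemma MV.transpose {t : ℕ} {A : Set ρ} {B : Set κ} (h : MV M t A B) : MV Mᵀ t B A := by
  intro r c hr hc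
  have := h c r hc hr
  rw [← det_transpose] at this
  exact this

lemma MV.mono {t : ℕ} {A A' : Set ρ} {B B' : Set κ} (h : MV M t A B) (hA : A' ⊆ A) (hB : B' ⊆ B) :
    MV M t A' B' := fun r c hr hc => h r c (fun i => hA (hr i)) (fun i => hB (hc i))

lemma MV.fintype {ι : Type*} [Fintype ι] [DecidableEq ι] {t : ℕ} {A : Set ρ} {B : Set κ}
    (h : MV M t A B) (hι : Fintype.card ι = t) (r : ι → ρ) (c : ι → κ) (hr : ∀ i, r i ∈ A)
    (hc : ∀ i, c i ∈ B) : (M.submatrix r c).det = 0 := by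
  have e : Fin t ≃ ι := (Fintype.equivFinOfCardEq hι).symm
  rw [← det_submatrix_equiv_self e]
  exact h (r ∘ e) (c ∘ e) (fun i => hr _) (fun i => hc _)

lemma det_mul_zero_of_card_lt {T : Type*} [Fintype T] {t : ℕ} (hT : Fintype.card T < t)
    (U : Matrix (Fin t) T R) (W : Matrix T (Fin t) R) : (U * W).det = 0 := by
  classical
  have hc : Fintype.card T < Fintype.card (Fin t) := by simpa using hT
  obtain ⟨e⟩ := Function.Embedding.nonempty_of_card_le hc.le
  have hns : ¬ Function.Surjective e := fun hs => by
    have := Fintype.card_le_of_surjective e hs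
    omega
  simp only [Function.Surjective, not_forall] at hns
  obtain ⟨x, hx⟩ := hns
  let U' : Matrix (Fin t) (Fin t) R := of fun i k => ∑ a, if e a = k then U i a else 0
  let W' : Matrix (Fin t) (Fin t) R := of fun k j => ∑ a, if e a = k then W a j else 0
  have : U * W = U' * W' := by
    ext i j
    simp only [mul_apply, U', W', of_apply, Finset.sum_mul]
    rw [Finset.sum_comm]
    refine Finset.sum_congr rfl fun a _ => ?_
    rw [Finset.sum_eq_single (e a)]
    · simp [e.injective.eq_iff]
    · intro b _ hb
      simp [Ne.symm hb]
    · simp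
  rw [this, det_mul, det_eq_zero_of_column_eq_zero (A := U') x, zero_mul]
  intro i
  refine Finset.sum_eq_zero fun a _ => ?_
  rw [if_neg]
  intro h
  exact hx ⟨a, h⟩

/-- bordered minors: columns -/
lemma MV.col_comb {s : ℕ} {A : Set ρ} {B : Set κ} (h : MV M (s + 1) A B) (I : Fin s → ρ)
    (J : Fin s → κ) (hI : ∀ k, I k ∈ A) (hJ : ∀ k, J k ∈ B) (hu : IsUnit (M.submatrix I J).det)
    (j : κ) (hj : j ∈ B) : ∃ γ : Fin s → R, ∀ i ∈ A, M i j = ∑ k, M i (J k) * γ k := by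
  refine ⟨(M.submatrix I J)⁻¹ *ᵥ (fun k => M (I k) j), fun i hi => ?_⟩
  have hd := h.fintype (ι := Unit ⊕ Fin s) (by simp [add_comm]) (Sum.elim (fun _ => i) I)
    (Sum.elim (fun _ => j) J) (by rintro (_ | k) <;> simp [hi, hI])
    (by rintro (_ | k) <;> simp [hj, hJ])
  let _ := (M.submatrix I J).invertibleOfIsUnitDet hu
  have e : M.submatrix (Sum.elim (fun _ : Unit => i) I) (Sum.elim (fun _ : Unit => j) J) =
      fromBlocks (of fun _ _ => M i j) (of fun _ k => M i (J k)) (of fun k _ => M (I k) j)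
        (M.submatrix I J) := by
    ext (_ | a) (_ | b) <;> simp
  rw [e, det_fromBlocks₂₂, hu.mul_right_eq_zero] at hd
  rw [det_unique, invOf_eq_nonsing_inv, Matrix.sub_apply, sub_eq_zero, Matrix.mul_assoc] at hd
  simpa [mul_apply, mulVec, dotProduct] using hd

lemma det_updateRow_sum_smul {t s : ℕ} (N : Matrix (Fin t) (Fin t) R) (l : Fin t) (γ : Fin s → R)
    (v : Fin s → Fin t → R) : (updateRow N l (∑ k, γ k • v k)).det =
      ∑ k, γ k * (updateRow N l (v k)).det := by
  classical
  generalize (Finset.univ : Finset (Fin s)) = T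
  induction T using Finset.induction_on with
  | empty =>
    simp only [Finset.sum_empty]
    refine det_eq_zero_of_row_eq_zero l ?_
    simp
  | insert a T ha ih =>
    rw [Finset.sum_insert ha, Finset.sum_insert ha, det_updateRow_add, det_updateRow_smul, ih]

lemma MV.insert_row {t s : ℕ} {A : Set ρ} {B : Set κ} (h : MV M t A B) (p : ρ) (I : Fin s → ρ)
    (hI : ∀ k, I k ∈ A) (γ : Fin s → R) (hγ : ∀ j ∈ B, M p j = ∑ k, γ k * M (I k) j) :
    MV M t (insert p A) B := by
  classical
  intro r c hr hc
  by_cases hp : ∃ l, r l = p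
  · obtain ⟨l, hl⟩ := hp
    by_cases hinj : ∃ l', l' ≠ l ∧ r l' = p
    · obtain ⟨l', hne, hl'⟩ := hinj
      refine det_zero_of_row_eq hne ?_
      ext j; simp [hl, hl']
    push Not at hinj
    have : M.submatrix r c = updateRow (M.submatrix r c) l
        (∑ k, γ k • fun j => M (I k) (c j)) := by
      ext a b
      by_cases hal : a = l
      · subst hal
        simp [hl, hγ _ (hc b)]
      · simp [updateRow_ne hal]
    rw [this]
    rw [det_updateRow_sum_smul]
    refine Finset.sum_eq_zero fun k _ => ?_
    have h0 := h (Function.update r l (I k)) c (fun i => by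
      by_cases hil : i = l
      · subst hil; simp [hI]
      · simpa [Function.update_of_ne hil] using (hr i).resolve_left (hinj i hil)) hc
    have e : M.submatrix (Function.update r l (I k)) c =
        updateRow (M.submatrix r c) l (fun j => M (I k) (c j)) := by
      ext a b
      by_cases hal : a = l
      · subst hal; simp
      · simp [Function.update_of_ne hal, updateRow_ne hal]
    rw [← e, h0, mul_zero]
  · push Not at hp
    exact h r c (fun i => (hr i).resolve_left (hp i)) hc

lemma MV.insert_col {t s : ℕ} {A : Set ρ} {B : Set κ} (h : MV M t A B) (q : κ) (J : Fin s → κ)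
    (hJ : ∀ k, J k ∈ B) (γ : Fin s → R) (hγ : ∀ i ∈ A, M i q = ∑ k, M i (J k) * γ k) :
    MV M t A (insert q B) := by
  refine (MV.insert_row (M := Mᵀ) h.transpose q J hJ γ fun j hj => ?_).transpose
  simp only [transpose_apply, hγ j hj, mul_comm]

/-- Key lemma 1. -/
lemma MV.key_col {t s : ℕ} {A A1 : Set ρ} {B B1 : Set κ} (h1 : MV M (s + 1) A1 B1)
    (h : MV M t A B) (I : Fin s → ρ) (J : Fin s → κ) (hI : ∀ k, I k ∈ A1) (hJ : ∀ k, J k ∈ B)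
    (hJ1 : ∀ k, J k ∈ B1) (hu : IsUnit (M.submatrix I J).det)
    (q : κ) (hq : q ∈ B1) (hA : A ⊆ A1) : MV M t A (insert q B) := by
  obtain ⟨γ, hγ⟩ := h1.col_comb I J hI hJ1 hu q hq
  exact h.insert_col q J hJ γ (fun i hi => hγ i (hA hi))

lemma isUnit_transpose_minor {s : ℕ} {I : Fin s → ρ} {J : Fin s → κ}
    (hu : IsUnit (M.submatrix I J).det) : IsUnit (Mᵀ.submatrix J I).det := by
  rw [← det_transpose] at hu
  exact hu

lemma MV.key_row {t s : ℕ} {A A1 : Set ρ} {B B1 : Set κ} (h1 : MV M (s + 1) A1 B1)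
    (h : MV M t A B) (I : Fin s → ρ) (J : Fin s → κ) (hI : ∀ k, I k ∈ A) (hJ : ∀ k, J k ∈ B1)
    (hI1 : ∀ k, I k ∈ A1) (hu : IsUnit (M.submatrix I J).det)
    (p : ρ) (hp : p ∈ A1) (hB : B ⊆ B1) : MV M t (insert p A) B :=
  (MV.key_col (M := Mᵀ) h1.transpose h.transpose J I hJ hI hI1 (isUnit_transpose_minor hu)
    p hp hB).transpose

lemma MV.succ_insert {s : ℕ} {A : Set ρ} {B : Set κ} (h : MV M s A B) (q : ρ) :
    MV M (s + 1) (insert q A) B := by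
  intro r c hr hc
  have key : ∀ l : Fin (s + 1), (∀ l', l' ≠ l → r l' ∈ A) → (M.submatrix r c).det = 0 := by
    intro l hl
    rw [det_succ_row _ l]
    refine Finset.sum_eq_zero fun j _ => ?_
    have h0 := h (r ∘ l.succAbove) (c ∘ j.succAbove) (fun i => hl _ (Fin.succAbove_ne l i))
      (fun i => hc _)
    rw [submatrix_submatrix, h0, mul_zero]
  by_cases hp : ∃ l, r l = q
  · obtain ⟨l, hl⟩ := hp
    by_cases hinj : ∃ l', l' ≠ l ∧ r l' = q
    · obtain ⟨l', hne, hl'⟩ := hinj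
      refine det_zero_of_row_eq hne ?_
      ext j; simp [hl, hl']
    push Not at hinj
    exact key l fun l' hl' => (hr l').resolve_left (hinj l' hl')
  · push Not at hp
    exact key 0 fun l' _ => (hr l').resolve_left (hp l')

/-- Key lemma 3. -/
lemma MV.key_two_row {t : ℕ} {A : Set ρ} {B : Set κ} (p q : ρ) (h1 : MV M (t + 1) (insert p A) B)
    (h2 : MV M (t + 1) (insert q A) B) (I : Fin (t + 1) → ρ) (J : Fin (t + 1) → κ)
    (kp kq : Fin (t + 1)) (hk : kp ≠ kq) (hp : I kp = p) (hq : I kq = q)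
    (hI : ∀ k, k ≠ kp → k ≠ kq → I k ∈ A) (hJ : ∀ k, J k ∈ B)
    (hu : IsUnit (M.submatrix I J).det) : MV M t A B := by
  classical
  have h3 := h1.succ_insert q
  have hI3 : ∀ k, I k ∈ insert q (insert p A) := by
    intro k
    by_cases hkp : k = kp
    · simp [hkp, hp]
    by_cases hkq : k = kq
    · simp [hkq, hq]
    simp [hI k hkp hkq]
  have hrow : ∀ a ∈ A, ∃ ν : Fin (t + 1) → R, ν kp = 0 ∧ ν kq = 0 ∧
      ∀ j ∈ B, M a j = ∑ k, ν k * M (I k) j := by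
    intro a ha
    obtain ⟨ν, hν⟩ := h3.transpose.col_comb J I hJ hI3 (isUnit_transpose_minor hu) a (by simp [ha])
    have hν' : ∀ j ∈ B, M a j = ∑ k, ν k * M (I k) j := by
      intro j hj
      have := hν j hj
      simp only [transpose_apply] at this
      simp only [this, mul_comm]
    have hz : ∀ l, (M.submatrix (Function.update I l a) J).det = 0 → ν l = 0 := by
      intro l hl
      have e : M.submatrix (Function.update I l a) J =
          updateRow (M.submatrix I J) l (∑ k, ν k • (M.submatrix I J) k) := by
        ext x y
        by_cases hx : x = l
        · subst hx; simp [hν' _ (hJ y)]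
        · simp [updateRow_ne hx, Function.update_of_ne hx]
      rw [e, det_updateRow_sum, smul_eq_mul, hu.mul_left_eq_zero] at hl
      exact hl
    refine ⟨ν, hz kp ?_, hz kq ?_, hν'⟩
    · refine h2 _ _ (fun i => ?_) hJ
      by_cases hkp : i = kp
      · subst hkp; simp [ha]
      rw [Function.update_of_ne hkp]
      by_cases hkq : i = kq
      · simp [hkq, hq]
      simp [hI i hkp hkq]
    · refine h1 _ _ (fun i => ?_) hJ
      by_cases hkq : i = kq
      · subst hkq; simp [ha]
      rw [Function.update_of_ne hkq]
      by_cases hkp : i = kp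
      · simp [hkp, hp]
      simp [hI i hkp hkq]
  intro r c hr hc
  choose ν hνp hνq hν using fun i => hrow (r i) (hr i)
  have e : M.submatrix r c = (of fun (i : Fin t) (k : {k // k ≠ kp ∧ k ≠ kq}) => ν i k) *
      (of fun (k : {k // k ≠ kp ∧ k ≠ kq}) j => M (I k) (c j)) := by
    ext i j
    simp only [submatrix_apply, mul_apply, of_apply, hν i _ (hc j)]
    rw [← Finset.sum_subtype (Finset.univ.filter fun k => k ≠ kp ∧ k ≠ kq) (by simp)
      (fun k => ν i k * M (I k) (c j))]
    symm
    refine Finset.sum_subset (Finset.filter_subset _ _) fun k _ hk' => ?_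
    have hk2 : k = kp ∨ k = kq := by
      by_contra hcon
      push Not at hcon
      exact hk' (by simp [hcon])
    rcases hk2 with rfl | rfl
    · rw [hνp, zero_mul]
    · rw [hνq, zero_mul]
  rw [e]
  refine det_mul_zero_of_card_lt ?_ _ _
  rw [Fintype.card_subtype]
  have hsub : (Finset.univ.filter fun k => k ≠ kp ∧ k ≠ kq) = (Finset.univ.erase kq).erase kp := by
    ext k; simp
  rw [hsub, Finset.card_erase_of_mem (by simp [hk]), Finset.card_erase_of_mem (by simp)]
  have := kp.2
  have := kq.2
  have : (kp : ℕ) ≠ kq := fun h => hk (Fin.ext h)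
  simp only [Finset.card_univ, Fintype.card_fin]
  omega

lemma MV.key_two_col {t : ℕ} {A : Set ρ} {B : Set κ} (p q : κ) (h1 : MV M (t + 1) A (insert p B))
    (h2 : MV M (t + 1) A (insert q B)) (I : Fin (t + 1) → ρ) (J : Fin (t + 1) → κ)
    (kp kq : Fin (t + 1)) (hk : kp ≠ kq) (hp : J kp = p) (hq : J kq = q)
    (hI : ∀ k, I k ∈ A) (hJ : ∀ k, k ≠ kp → k ≠ kq → J k ∈ B)
    (hu : IsUnit (M.submatrix I J).det) : MV M t A B :=
  (MV.key_two_row (M := Mᵀ) p q h1.transpose h2.transpose J I kp kq hk hp hq hJ hI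
    (isUnit_transpose_minor hu)).transpose
end MVsec

/-! ### combinatorics -/

lemma chain_height {m n : ℕ} (s : ℕ) : ∀ (U : Set (Fin m × Fin n)),
    (∀ (r : Fin (s + 1) → Fin m) (c : Fin (s + 1) → Fin n), StrictMono r → StrictMono c →
      ∃ k, (r k, c k) ∉ U) →
    ∃ h : Fin m × Fin n → ℕ, (∀ x ∈ U, h x < s) ∧
      ∀ x ∈ U, ∀ y ∈ U, x.1 < y.1 → x.2 < y.2 → h x < h y := by
  classical
  induction s with
  | zero =>
    intro U hU
    have hem : ∀ x, x ∉ U := by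
      intro x hx
      obtain ⟨k, hk⟩ := hU (fun _ => x.1) (fun _ => x.2)
        (fun a b h => absurd h (by rw [Fin.lt_def]; omega))
        (fun a b h => absurd h (by rw [Fin.lt_def]; omega))
      exact hk hx
    exact ⟨fun _ => 0, fun x hx => absurd hx (hem x), fun x hx => absurd hx (hem x)⟩
  | succ s ih =>
    intro U hU
    let U' : Set (Fin m × Fin n) := {x | x ∈ U ∧ ∃ y ∈ U, y.1 < x.1 ∧ y.2 < x.2}
    obtain ⟨h', h1, h2⟩ := ih U' (by
      intro r c hr hc
      by_contra hcon
      push Not at hcon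
      obtain ⟨_, y, hyU, hy1, hy2⟩ := hcon 0
      obtain ⟨k, hk⟩ := hU (Fin.cons y.1 r) (Fin.cons y.2 c)
        (by
          refine Fin.strictMono_iff_lt_succ.2 fun i => ?_
          refine Fin.cases ?_ (fun i => ?_) i
          · simpa using hy1
          · simpa [← Fin.succ_castSucc] using hr (Fin.castSucc_lt_succ))
        (by
          refine Fin.strictMono_iff_lt_succ.2 fun i => ?_
          refine Fin.cases ?_ (fun i => ?_) i
          · simpa using hy2
          · simpa [← Fin.succ_castSucc] using hc (Fin.castSucc_lt_succ))
      revert hk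
      refine Fin.cases ?_ (fun i => ?_) k
      · simpa using hyU
      · simpa using (hcon i).1)
    refine ⟨fun x => if x ∈ U' then h' x + 1 else 0, ?_, ?_⟩
    · intro x hx
      by_cases hx' : x ∈ U'
      · simpa [hx'] using h1 x hx'
      · simp [hx']
    · intro x hx y hy h3 h4
      have hy' : y ∈ U' := ⟨hy, x, hx, h3, h4⟩
      by_cases hx' : x ∈ U'
      · simpa [hx', hy'] using h2 x hx' y hy' h3 h4
      · simp [hx', hy']

lemma potential {m n : ℕ} (hn : 0 < n) (p q : ℕ → ℤ) (hp : Monotone p) (hq : Monotone q)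
    (hp0 : ∀ i, 0 ≤ p i) (hq0 : ∀ j, 0 ≤ q j) (D : Finset (Fin m × Fin n))
    (hD : ∀ x ∈ D, ∀ y ∈ D, x.1 < y.1 → ¬ x.2 < y.2) :
    ∃ (α : Fin m → ℤ) (β : Fin n → ℤ), (∀ i j, α i + β j ≤ p i * q j) ∧
      (∀ x ∈ D, α x.1 + β x.2 = p x.1 * q x.2) ∧ (∀ j, 0 ≤ β j) ∧ ∀ i, -(p m * q n) ≤ α i := by
  classical
  let ρ : ℕ → ℕ := fun l => (D.filter fun x => l < (x.2 : ℕ)).sup fun x => (x.1 : ℕ)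
  let b : ℕ → ℤ := fun j => ∑ l ∈ Finset.range j, p (ρ l) * (q (l + 1) - q l)
  have bs : ∀ l, b (l + 1) = b l + p (ρ l) * (q (l + 1) - q l) := fun l => by
    simp [b, Finset.sum_range_succ]
  have hqs : ∀ l, 0 ≤ q (l + 1) - q l := fun l => sub_nonneg.2 (hq (Nat.le_succ l))
  have hρ1 : ∀ x ∈ D, ∀ l, (x.2 : ℕ) ≤ l → ρ l ≤ x.1 := by
    intro x hx l hl
    refine Finset.sup_le fun y hy => ?_
    rw [Finset.mem_filter] at hy
    by_contra hcon
    exact hD x hx y hy.1 (by rw [Fin.lt_def]; omega) (by rw [Fin.lt_def]; omega)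
  have hρ2 : ∀ x ∈ D, ∀ l, l < (x.2 : ℕ) → (x.1 : ℕ) ≤ ρ l := by
    intro x hx l hl
    exact Finset.le_sup (f := fun x : Fin m × Fin n => (x.1 : ℕ)) (by simp [hx, hl])
  have hρm : ∀ l, ρ l ≤ m := fun l => Finset.sup_le fun y _ => y.1.2.le
  have hb0 : ∀ j, 0 ≤ b j := fun j => Finset.sum_nonneg fun l _ => mul_nonneg (hp0 _) (hqs l)
  have hbm : ∀ j, b j ≤ p m * q j := by
    intro j
    induction j with
    | zero => simpa [b] using mul_nonneg (hp0 m) (hq0 0)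
    | succ j ih =>
      rw [bs]
      have := mul_le_mul_of_nonneg_right (hp (hρm j)) (hqs j)
      linarith
  have hmin : ∀ i : Fin m, ∃ j0 : Fin n, ∀ j : Fin n, p i * q j0 - b j0 ≤ p i * q j - b j := by
    intro i
    obtain ⟨j0, _, h⟩ := Finset.exists_min_image (Finset.univ : Finset (Fin n))
      (fun j => p i * q j - b j) ⟨⟨0, hn⟩, Finset.mem_univ _⟩
    exact ⟨j0, fun j => h j (Finset.mem_univ _)⟩
  choose j0 hj0 using hmin
  refine ⟨fun i => p i * q (j0 i) - b (j0 i), fun j => b j, ?_, ?_, fun j => hb0 j, ?_⟩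
  · intro i j
    have := hj0 i j
    linarith
  · intro x hx
    have up : ∀ j, (x.2 : ℕ) ≤ j → p x.1 * q x.2 - b x.2 ≤ p x.1 * q j - b j := by
      intro j hj
      induction j, hj using Nat.le_induction with
      | base => exact le_rfl
      | succ j hj ih =>
        rw [bs]
        have := mul_le_mul_of_nonneg_right (hp (hρ1 x hx j hj)) (hqs j)
        linarith
    have down : ∀ d j, j + d = (x.2 : ℕ) → p x.1 * q x.2 - b x.2 ≤ p x.1 * q j - b j := by
      intro d
      induction d with
      | zero => intro j hj; simp at hj; rw [hj]
      | succ d ih =>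
        intro j hj
        have h1 := ih (j + 1) (by omega)
        rw [bs] at h1
        have := mul_le_mul_of_nonneg_right (hp (hρ2 x hx j (by omega))) (hqs j)
        linarith
    have h1 := hj0 x.1 x.2
    have h2 : p x.1 * q x.2 - b x.2 ≤ p x.1 * q (j0 x.1) - b (j0 x.1) := by
      rcases le_total (x.2 : ℕ) (j0 x.1 : ℕ) with h | h
      · exact up _ h
      · exact down (x.2 - j0 x.1) _ (by omega)
    simp only
    linarith
  · intro i
    have h1 := hbm (j0 i)
    have h2 := mul_nonneg (hp0 i) (hq0 (j0 i))
    have h3 := mul_le_mul_of_nonneg_left (hq (j0 i).2.le) (hp0 m)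
    simp only
    linarith

/-! ### weights -/

def cellW (m n Bs : ℕ) (x : Fin m × Fin n) : ℕ :=
  Bs ^ ((x.1 : ℕ) * n) * Bs ^ (x.2 : ℕ) + Bs ^ (m * n + n)

def wt (m n Bs : ℕ) (v : Fin m × Fin n →₀ ℕ) : ℕ := ∑ x, v x * cellW m n Bs x

lemma wt_add (m n Bs : ℕ) (v v' : Fin m × Fin n →₀ ℕ) :
    wt m n Bs (v + v') = wt m n Bs v + wt m n Bs v' := by
  simp [wt, add_mul, Finset.sum_add_distrib]

lemma wt_single (m n Bs : ℕ) (x : Fin m × Fin n) :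
    wt m n Bs (Finsupp.single x 1) = cellW m n Bs x := by
  classical
  simp [wt, Finsupp.single_apply]

lemma wt_sum (m n Bs : ℕ) {ι : Type*} (T : Finset ι) (v : ι → Fin m × Fin n →₀ ℕ) :
    wt m n Bs (∑ i ∈ T, v i) = ∑ i ∈ T, wt m n Bs (v i) := by
  classical
  induction T using Finset.induction_on with
  | empty => simp [wt]
  | insert a T ha ih => rw [Finset.sum_insert ha, Finset.sum_insert ha, wt_add, ih]

lemma wt_inj {m n Bs : ℕ} {v v' : Fin m × Fin n →₀ ℕ} (hv : ∀ x, v x < Bs) (hv' : ∀ x, v' x < Bs)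
    (h : wt m n Bs v = wt m n Bs v') : v = v' := by
  have low : ∀ (v : Fin m × Fin n →₀ ℕ) (hv : ∀ x, v x < Bs), wt m n Bs v % Bs ^ (m * n) =
      (finFunctionFinEquiv (fun e : Fin (m * n) => (⟨v (finProdFinEquiv.symm e), hv _⟩ : Fin Bs)) :
        Fin (Bs ^ (m * n))).val := by
    intro v hv
    have h1 : wt m n Bs v = (finFunctionFinEquiv (fun e : Fin (m * n) =>
        (⟨v (finProdFinEquiv.symm e), hv _⟩ : Fin Bs)) : Fin (Bs ^ (m * n))).val +
        Bs ^ (m * n) * ((∑ x, v x) * Bs ^ n) := by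
      rw [finFunctionFinEquiv_apply]
      simp only [wt, cellW, mul_add, Finset.sum_add_distrib]
      congr 1
      · rw [← finProdFinEquiv.sum_comp]
        refine Finset.sum_congr rfl fun x _ => ?_
        simp only [Equiv.symm_apply_apply, finProdFinEquiv_apply_val]
        rw [← pow_add]
        ring_nf
      · rw [← Finset.sum_mul, pow_add]
        ring
    rw [h1, Nat.add_mul_mod_self_left, Nat.mod_eq_of_lt (Fin.isLt _)]
  have h2 := low v hv
  rw [h, low v' hv', Fin.val_inj] at h2
  have h3 := finFunctionFinEquiv.injective h2
  ext x
  have h4 := congrFun h3 (finProdFinEquiv x)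
  simpa using h4.symm

lemma wt_diag {m n Bs t : ℕ} (hBs : 2 ≤ Bs) (hn : 0 < n) (r : Fin t → Fin m) (c : Fin t → Fin n)
    (hr : StrictMono r)
    (hc : StrictMono c) (σ : Equiv.Perm (Fin t)) (hσ : σ ≠ 1) :
    ∑ k, cellW m n Bs (r (σ k), c k) < ∑ k, cellW m n Bs (r k, c k) := by
  have hp : StrictMono fun k : Fin t => Bs ^ ((r k : ℕ) * n) := fun a b hab =>
    Nat.pow_lt_pow_right (by omega) (Nat.mul_lt_mul_of_pos_right (hr hab) hn)
  have hq : StrictMono fun k : Fin t => Bs ^ (c k : ℕ) := fun a b hab =>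
    Nat.pow_lt_pow_right (by omega) (hc hab)
  simp only [cellW, Finset.sum_add_distrib, add_lt_add_iff_right]
  have hmv : Monovary (fun k : Fin t => Bs ^ ((r k : ℕ) * n)) (fun k : Fin t => Bs ^ (c k : ℕ)) :=
    hp.monotone.monovary hq.monotone
  refine (hmv.sum_comp_perm_mul_lt_sum_mul_iff (σ := σ)).2 ?_
  intro hcon
  apply hσ
  have hmono : Monotone σ := by
    intro a b hab
    rcases hab.eq_or_lt with rfl | hab
    · exact le_rfl
    · exact hp.le_iff_le.1 (hcon (hq hab))
  have : StrictMono σ := hmono.strictMono_of_injective σ.injective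
  ext k
  have h := Subsingleton.elim (α := Fin t ≃o Fin t)
    (StrictMono.orderIsoOfSurjective σ this σ.surjective) (OrderIso.refl _)
  have := congrArg (fun e : Fin t ≃o Fin t => (e k : ℕ)) h
  simpa using this

/-! ### the second fundamental theorem -/

def iv (N a b : ℕ) : Set (Fin N) := {i | a ≤ i.val + 1 ∧ i.val + 1 ≤ b}

noncomputable def genX (K : Type*) [Field K] (m n : ℕ) :
    Matrix (Fin m) (Fin n) (MvPolynomial (Fin m × Fin n) K) :=
  of fun i j => MvPolynomial.X (i, j)

lemma genMinors_le_ker_iff {K R : Type*} [Field K] [CommRing R] {m n t r1 r2 c1 c2 : ℕ}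
    (θ : MvPolynomial (Fin m × Fin n) K →+* R) :
    genMinors K m n t r1 r2 c1 c2 ≤ RingHom.ker θ ↔
      MV ((genX K m n).map θ) t (iv m r1 r2) (iv n c1 c2) := by
  have hdet : ∀ (r : Fin t → Fin m) (c : Fin t → Fin n),
      θ (Matrix.det (Matrix.of fun i j => MvPolynomial.X (r i, c j))) =
      (((genX K m n).map θ).submatrix r c).det := by
    intro r c
    rw [RingHom.map_det]
    rfl
  constructor
  · intro h r c hr hc
    by_cases hri : Function.Injective r
    swap
    · simp only [Function.Injective, not_forall] at hri
      obtain ⟨a, b, hab, hne⟩ := hri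
      refine det_zero_of_row_eq hne ?_
      ext j; simp [hab]
    by_cases hci : Function.Injective c
    swap
    · simp only [Function.Injective, not_forall] at hci
      obtain ⟨a, b, hab, hne⟩ := hci
      refine det_zero_of_column_eq hne ?_
      intro j; simp [hab]
    have hr' : StrictMono (r ∘ Tuple.sort r) := (Tuple.monotone_sort r).strictMono_of_injective
      (hri.comp (Tuple.sort r).injective)
    have hc' : StrictMono (c ∘ Tuple.sort c) := (Tuple.monotone_sort c).strictMono_of_injective
      (hci.comp (Tuple.sort c).injective)
    have hm : θ (Matrix.det (Matrix.of fun i j =>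
        MvPolynomial.X ((r ∘ Tuple.sort r) i, (c ∘ Tuple.sort c) j))) = 0 :=
      h (Ideal.subset_span ⟨_, _, hr', hc', fun i => hr _, fun i => hc _, rfl⟩)
    rw [hdet] at hm
    have e : ((genX K m n).map θ).submatrix (r ∘ Tuple.sort r) (c ∘ Tuple.sort c) =
      ((((genX K m n).map θ).submatrix r c).submatrix (Tuple.sort r) id).submatrix id
        (Tuple.sort c) := rfl
    rw [e, det_permute', det_permute] at hm
    have hu : ∀ σ : Equiv.Perm (Fin t), IsUnit (((Equiv.Perm.sign σ : ℤˣ) : ℤ) : R) := by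
      intro σ
      exact ((Equiv.Perm.sign σ).isUnit).map (Int.castRingHom R)
    rwa [(hu _).mul_right_eq_zero, (hu _).mul_right_eq_zero] at hm
  · intro h
    refine Ideal.span_le.2 ?_
    rintro _ ⟨r, c, _, _, hr, hc, rfl⟩
    simp only [SetLike.mem_coe, RingHom.mem_ker]
    rw [hdet]
    exact h r c hr hc

open MvPolynomial in
noncomputable def phi (K : Type*) [Field K] (m n s r1 r2 c1 c2 : ℕ) :
    MvPolynomial (Fin m × Fin n) K →ₐ[K]
      MvPolynomial ((Fin m × Fin s) ⊕ ((Fin s × Fin n) ⊕ (Fin m × Fin n))) K :=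
  open Classical in
  aeval fun x => if x.1 ∈ iv m r1 r2 ∧ x.2 ∈ iv n c1 c2 then
    ∑ k, X (Sum.inl (x.1, k)) * X (Sum.inr (Sum.inl (k, x.2))) else X (Sum.inr (Sum.inr x))

lemma genMinors_le_ker_phi (K : Type*) [Field K] (m n s r1 r2 c1 c2 : ℕ) :
    genMinors K m n (s + 1) r1 r2 c1 c2 ≤ RingHom.ker (phi K m n s r1 r2 c1 c2) := by
  classical
  change _ ≤ RingHom.ker (phi K m n s r1 r2 c1 c2).toRingHom
  rw [genMinors_le_ker_iff]
  intro r c hr hc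
  let U : Matrix (Fin (s + 1)) (Fin s)
      (MvPolynomial ((Fin m × Fin s) ⊕ ((Fin s × Fin n) ⊕ (Fin m × Fin n))) K) :=
    of fun i (k : Fin s) => MvPolynomial.X (Sum.inl (r i, k))
  let W : Matrix (Fin s) (Fin (s + 1))
      (MvPolynomial ((Fin m × Fin s) ⊕ ((Fin s × Fin n) ⊕ (Fin m × Fin n))) K) :=
    of fun (k : Fin s) j => MvPolynomial.X (Sum.inr (Sum.inl (k, c j)))
  have e : ((genX K m n).map (phi K m n s r1 r2 c1 c2).toRingHom).submatrix r c = U * W := by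
    refine Matrix.ext fun i j => ?_
    rw [Matrix.mul_apply]
    simp [genX, phi, hr i, hc j, U, W]
  rw [e]
  exact det_mul_zero_of_card_lt (by simp) _ _

open Polynomial in
lemma coeff_prod_pow_aux {ι R : Type*} [CommRing R] (T : Finset ι) (ψ : ι → R[X])
    (w e : ι → ℕ) (h : ∀ x, (ψ x).natDegree ≤ w x) :
    (∏ x ∈ T, ψ x ^ e x).coeff (∑ x ∈ T, e x * w x) = ∏ x ∈ T, ((ψ x).coeff (w x)) ^ e x := by
  classical
  induction T using Finset.induction_on with
  | empty => simp
  | insert a T ha ih =>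
    rw [Finset.prod_insert ha, Finset.sum_insert ha, Finset.prod_insert ha,
      coeff_mul_add_eq_of_natDegree_le, coeff_pow_of_natDegree_le (h a), ih]
    · exact natDegree_pow_le.trans (Nat.mul_le_mul_left _ (h a))
    · refine (natDegree_prod_le _ _).trans (Finset.sum_le_sum fun x _ => ?_)
      exact natDegree_pow_le.trans (Nat.mul_le_mul_left _ (h x))

open Polynomial in
/-- The leading monomial of a nonzero element of the kernel contains a long chain. -/
lemma lead_chain {K : Type*} [Field K] {m n s r1 r2 c1 c2 Bs : ℕ} (hn : 0 < n) (hBs : 2 ≤ Bs)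
    (F : MvPolynomial (Fin m × Fin n) K) (hF : phi K m n s r1 r2 c1 c2 F = 0)
    (u : Fin m × Fin n →₀ ℕ) (hu : u ∈ F.support)
    (hlead : ∀ v ∈ F.support, v ≠ u → wt m n Bs v < wt m n Bs u) :
    ∃ (r : Fin (s + 1) → Fin m) (c : Fin (s + 1) → Fin n), StrictMono r ∧ StrictMono c ∧
      ∀ k, r k ∈ iv m r1 r2 ∧ c k ∈ iv n c1 c2 ∧ u (r k, c k) ≠ 0 := by
  classical
  by_contra hcon
  push Not at hcon
  obtain ⟨h, hs, hmono⟩ := chain_height s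
    {x : Fin m × Fin n | x.1 ∈ iv m r1 r2 ∧ x.2 ∈ iv n c1 c2 ∧ u x ≠ 0} (by
      intro r c hr hc
      obtain ⟨k, hk⟩ := hcon r c hr hc
      refine ⟨k, fun hmem => hmem.2.2 (hk hmem.1 hmem.2.1)⟩)
  have hpot := fun k : Fin s => potential (m := m) hn (fun i => (Bs : ℤ) ^ (i * n))
    (fun j => (Bs : ℤ) ^ j)
    (fun a b hab => pow_le_pow_right₀ (by exact_mod_cast (by omega : 1 ≤ Bs))
      (Nat.mul_le_mul_right n hab))
    (fun a b hab => pow_le_pow_right₀ (by exact_mod_cast (by omega : 1 ≤ Bs)) hab)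
    (fun i => by positivity) (fun i => by positivity)
    (Finset.univ.filter fun x : Fin m × Fin n =>
      (x.1 ∈ iv m r1 r2 ∧ x.2 ∈ iv n c1 c2 ∧ u x ≠ 0) ∧ h x = k)
    (by
      intro x hx y hy h1 h2
      simp only [Finset.mem_filter, Finset.mem_univ, true_and] at hx hy
      have := hmono x hx.1 y hy.1 h1 h2
      omega)
  choose α β hle heq hβ hα using hpot
  -- natural number exponents
  have hex : ∀ k : Fin s, ∃ (a : Fin m → ℕ) (b : Fin n → ℕ),
      (∀ i j, a i + b j ≤ cellW m n Bs (i, j)) ∧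
      ∀ x : Fin m × Fin n, x.1 ∈ iv m r1 r2 → x.2 ∈ iv n c1 c2 → u x ≠ 0 → h x = k →
        a x.1 + b x.2 = cellW m n Bs x := by
    intro k
    have hα' : ∀ i, 0 ≤ α k i + (Bs : ℤ) ^ (m * n + n) := by
      intro i
      have := hα k i
      rw [← pow_add] at this
      linarith
    refine ⟨fun i => (α k i + (Bs : ℤ) ^ (m * n + n)).toNat, fun j => (β k j).toNat, ?_, ?_⟩
    · intro i j
      zify
      rw [Int.toNat_of_nonneg (hα' i), Int.toNat_of_nonneg (hβ k j)]
      have := hle k i j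
      simp only [cellW]
      push_cast
      linarith
    · intro x h1 h2 h3 h4
      zify
      rw [Int.toNat_of_nonneg (hα' _), Int.toNat_of_nonneg (hβ k _)]
      have := heq k x (by simp [h1, h2, h3, h4])
      simp only [cellW]
      push_cast
      linarith
  choose a b hab heq' using hex
  let χ : MvPolynomial ((Fin m × Fin s) ⊕ ((Fin s × Fin n) ⊕ (Fin m × Fin n))) K →ₐ[K]
      (MvPolynomial (Fin s) K)[X] :=
    MvPolynomial.aeval (Sum.elim (fun y => C (MvPolynomial.X y.2) * X ^ (a y.2 y.1))
      (Sum.elim (fun z => X ^ (b z.1 z.2)) (fun x => X ^ (cellW m n Bs x))))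
  let ψ : Fin m × Fin n → (MvPolynomial (Fin s) K)[X] := fun x =>
    if x.1 ∈ iv m r1 r2 ∧ x.2 ∈ iv n c1 c2 then
      ∑ k, C (MvPolynomial.X k) * X ^ (a k x.1 + b k x.2) else X ^ (cellW m n Bs x)
  have hχ : χ.comp (phi K m n s r1 r2 c1 c2) = MvPolynomial.aeval ψ := by
    refine MvPolynomial.algHom_ext fun x => ?_
    simp only [AlgHom.comp_apply, phi, MvPolynomial.aeval_X, ψ, χ]
    split_ifs with hx
    · simp [pow_add, mul_assoc]
    · simp
  have hψdeg : ∀ x, (ψ x).natDegree ≤ cellW m n Bs x := by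
    intro x
    simp only [ψ]
    split_ifs with hx
    · refine natDegree_sum_le_of_forall_le _ _ fun k _ => ?_
      exact (natDegree_C_mul_X_pow_le _ _).trans (hab k _ _)
    · exact natDegree_X_pow_le _
  have hψlead : ∀ x, u x ≠ 0 → (ψ x).coeff (cellW m n Bs x) ≠ 0 := by
    intro x hux
    simp only [ψ]
    split_ifs with hx
    · rw [finsetSum_coeff]
      intro h0
      have hhx := hs x ⟨hx.1, hx.2, hux⟩
      have h1 := congrArg (MvPolynomial.eval (Pi.single (⟨h x, hhx⟩ : Fin s) (1 : K))) h0
      rw [map_sum, map_zero, Finset.sum_eq_single (⟨h x, hhx⟩ : Fin s)] at h1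
      · rw [heq' ⟨h x, hhx⟩ x hx.1 hx.2 hux rfl] at h1
        simp at h1
      · intro k _ hk
        rw [coeff_C_mul, map_mul]
        simp [hk]
      · simp
    · simp
  have hprod : ∀ v : Fin m × Fin n →₀ ℕ, (∏ x, ψ x ^ v x).natDegree ≤ wt m n Bs v := by
    intro v
    refine (natDegree_prod_le _ _).trans (Finset.sum_le_sum fun x _ => ?_)
    exact natDegree_pow_le.trans (Nat.mul_le_mul_left _ (hψdeg x))
  have hprodc : (∏ x, ψ x ^ u x).coeff (wt m n Bs u) ≠ 0 := by
    have : (∏ x, ψ x ^ u x).coeff (wt m n Bs u) =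
        ∏ x, ((ψ x).coeff (cellW m n Bs x)) ^ u x := by
      exact coeff_prod_pow_aux _ _ _ _ hψdeg
    rw [this]
    refine Finset.prod_ne_zero_iff.2 fun x _ => ?_
    by_cases hux : u x = 0
    · simp [hux]
    · exact pow_ne_zero _ (hψlead x hux)
  have hF0 : MvPolynomial.aeval ψ F = 0 := by
    rw [← hχ, AlgHom.comp_apply, hF, map_zero]
  rw [MvPolynomial.aeval_def, MvPolynomial.eval₂_eq'] at hF0
  have h1 := congrArg (fun P => coeff P (wt m n Bs u)) hF0
  simp only [finsetSum_coeff, coeff_zero] at h1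
  rw [Finset.sum_eq_single u] at h1
  · rw [IsScalarTower.algebraMap_apply K (MvPolynomial (Fin s) K), Polynomial.algebraMap_eq,
      coeff_C_mul, mul_eq_zero] at h1
    rcases h1 with h1 | h1
    · rw [MvPolynomial.algebraMap_eq, MvPolynomial.C_eq_zero] at h1
      exact (MvPolynomial.mem_support_iff.1 hu) h1
    · exact hprodc h1
  · intro v hv hvu
    rw [IsScalarTower.algebraMap_apply K (MvPolynomial (Fin s) K), Polynomial.algebraMap_eq,
      coeff_C_mul, coeff_eq_zero_of_natDegree_lt ((hprod v).trans_lt (hlead v hv hvu)), mul_zero]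
  · intro h2
    exact absurd hu h2

open MvPolynomial in
lemma reduce_aux {K : Type*} [Field K] {m n s r1 r2 c1 c2 Bs : ℕ} (hn : 0 < n) (hBs : 2 ≤ Bs) :
    ∀ (N : ℕ) (F : MvPolynomial (Fin m × Fin n) K), phi K m n s r1 r2 c1 c2 F = 0 →
    (∀ v ∈ F.support, v.degree < Bs ∧ wt m n Bs v < N) →
    F ∈ genMinors K m n (s + 1) r1 r2 c1 c2 := by
  classical
  intro N
  induction N using Nat.strong_induction_on with
  | _ N ih =>
  intro F hF hb
  by_cases hF0 : F = 0
  · rw [hF0]; exact Ideal.zero_mem _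
  have hdig : ∀ v : Fin m × Fin n →₀ ℕ, v.degree < Bs → ∀ x, v x < Bs := fun v hv x =>
    (Finsupp.le_degree x v).trans_lt hv
  obtain ⟨u, hu, hmax⟩ := Finset.exists_max_image F.support (wt m n Bs)
    (by rwa [Finset.nonempty_iff_ne_empty, Ne, MvPolynomial.support_eq_empty])
  have hlead : ∀ v ∈ F.support, v ≠ u → wt m n Bs v < wt m n Bs u := by
    intro v hv hne
    refine lt_of_le_of_ne (hmax v hv) fun h => hne ?_
    exact wt_inj (hdig v (hb v hv).1) (hdig u (hb u hu).1) h
  obtain ⟨r, c, hr, hc, hrc⟩ := lead_chain hn hBs F hF u hu hlead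
  -- the minor
  set D : MvPolynomial (Fin m × Fin n) K :=
    Matrix.det (Matrix.of fun i j => MvPolynomial.X (r i, c j)) with hD
  have hDmem : D ∈ genMinors K m n (s + 1) r1 r2 c1 c2 :=
    Ideal.subset_span ⟨r, c, hr, hc, fun i => (hrc i).1, fun i => (hrc i).2.1, rfl⟩
  let d : Equiv.Perm (Fin (s + 1)) → Fin m × Fin n →₀ ℕ := fun σ =>
    ∑ k, Finsupp.single (r (σ k), c k) 1
  have hDexp : D = ∑ σ : Equiv.Perm (Fin (s + 1)),
      monomial (d σ) ((((Equiv.Perm.sign σ : ℤˣ) : ℤ) : K)) := by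
    rw [hD, Matrix.det_apply']
    refine Finset.sum_congr rfl fun σ _ => ?_
    have h1 : ∏ k, (Matrix.of fun i j => (X (r i, c j) : MvPolynomial (Fin m × Fin n) K)) (σ k) k =
        monomial (d σ) 1 := by
      simp only [Matrix.of_apply, d, X]
      rw [MvPolynomial.monomial_sum_one]
    rw [h1, ← mul_one ((((Equiv.Perm.sign σ : ℤˣ) : ℤ) : K)), ← C_mul_monomial]
    simp
  have hdu : d 1 ≤ u := by
    intro x
    simp only [d, Finsupp.coe_finsetSum, Finset.sum_apply, Finsupp.single_apply,
      Equiv.Perm.one_apply]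
    by_cases hx : ∃ k, (r k, c k) = x
    · obtain ⟨k, rfl⟩ := hx
      rw [Finset.sum_eq_single k]
      · simpa [Nat.one_le_iff_ne_zero] using (hrc k).2.2
      · intro l _ hl
        rw [if_neg]
        intro h
        exact hl (hr.injective (Prod.ext_iff.1 h).1)
      · simp
    · push Not at hx
      rw [Finset.sum_eq_zero]
      · exact Nat.zero_le _
      · intro k _
        rw [if_neg (hx k)]
  have hdeg : ∀ σ, (d σ).degree = s + 1 := by
    intro σ
    simp [d]
  set F' := F - monomial (u - d 1) (coeff u F) * D with hF'
  have hF'mem : F' ∈ restrictSupport K {v : Fin m × Fin n →₀ ℕ |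
      v.degree < Bs ∧ wt m n Bs v < wt m n Bs u} := by
    have e : F' = (∑ v ∈ F.support.erase u, monomial v (coeff v F)) -
        ∑ σ ∈ Finset.univ.erase (1 : Equiv.Perm (Fin (s + 1))),
          monomial (u - d 1 + d σ) (coeff u F * (((Equiv.Perm.sign σ : ℤˣ) : ℤ) : K)) := by
      have h1 : F = monomial u (coeff u F) +
          ∑ v ∈ F.support.erase u, monomial v (coeff v F) := by
        rw [Finset.add_sum_erase _ (fun v => monomial v (coeff v F)) hu]
        exact F.as_sum
      have h2 : monomial (u - d 1) (coeff u F) * D = monomial u (coeff u F) +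
          ∑ σ ∈ Finset.univ.erase (1 : Equiv.Perm (Fin (s + 1))),
          monomial (u - d 1 + d σ) (coeff u F * (((Equiv.Perm.sign σ : ℤˣ) : ℤ) : K)) := by
        rw [hDexp, Finset.mul_sum, ← Finset.add_sum_erase _ _ (Finset.mem_univ 1)]
        simp only [monomial_mul]
        congr 1
        rw [tsub_add_cancel_of_le hdu]
        simp
      rw [hF', h2]
      nth_rewrite 1 [h1]
      ring
    rw [e]
    refine Submodule.sub_mem _ (Submodule.sum_mem _ fun v hv => ?_)
      (Submodule.sum_mem _ fun σ hσ => ?_)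
    · rw [Finset.mem_erase] at hv
      exact (MvPolynomial.monomial_mem_restrictSupport K).2 (Or.inl ⟨(hb v hv.2).1, hlead v hv.2 hv.1⟩)
    · refine (MvPolynomial.monomial_mem_restrictSupport K).2 (Or.inl ⟨?_, ?_⟩)
      · have h1 : (u - d 1 + d 1).degree = u.degree := by rw [tsub_add_cancel_of_le hdu]
        rw [map_add, hdeg] at h1 ⊢
        rw [h1]
        exact (hb u hu).1
      · have h1 : wt m n Bs (u - d 1 + d 1) = wt m n Bs u := by rw [tsub_add_cancel_of_le hdu]
        rw [← h1, wt_add, wt_add]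
        have h2 := wt_diag hBs hn r c hr hc σ (Finset.ne_of_mem_erase hσ)
        simp only [d, wt_sum, wt_single, Equiv.Perm.one_apply]
        omega
  have hF'ker : phi K m n s r1 r2 c1 c2 F' = 0 := by
    rw [hF', map_sub, hF, map_mul, RingHom.mem_ker.1 (genMinors_le_ker_phi K m n s r1 r2 c1 c2 hDmem)]
    simp
  have hres := ih (wt m n Bs u) (hb u hu).2 F' hF'ker (fun v hv => ((MvPolynomial.mem_restrictSupport_iff K).1 hF'mem) hv)
  have : F = F' + monomial (u - d 1) (coeff u F) * D := by rw [hF']; ring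
  rw [this]
  exact Ideal.add_mem _ hres (Ideal.mul_mem_left _ _ hDmem)

theorem genMinors_eq_ker {K : Type*} [Field K] {m n s r1 r2 c1 c2 : ℕ} (hn : 0 < n) :
    genMinors K m n (s + 1) r1 r2 c1 c2 = RingHom.ker (phi K m n s r1 r2 c1 c2) := by
  refine le_antisymm (genMinors_le_ker_phi K m n s r1 r2 c1 c2) fun F hF => ?_
  refine reduce_aux (Bs := F.totalDegree + 2) hn (by omega)
    (F.support.sup (wt m n (F.totalDegree + 2)) + 1) F hF fun v hv => ⟨?_, ?_⟩
  · have := MvPolynomial.le_totalDegree hv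
    rw [Finsupp.degree_eq_sum]
    rw [Finsupp.sum_fintype _ _ (by simp)] at this
    omega
  · exact Nat.lt_succ_of_le (Finset.le_sup (f := wt m n (F.totalDegree + 2)) hv)

theorem genMinors_isPrime {K : Type*} [Field K] {m n t r1 r2 c1 c2 : ℕ} (hn : 0 < n) (ht : 1 ≤ t) :
    (genMinors K m n t r1 r2 c1 c2).IsPrime := by
  obtain ⟨s, rfl⟩ := Nat.exists_eq_add_of_le' ht
  rw [genMinors_eq_ker hn]
  exact RingHom.ker_isPrime _

/-! ### colon step -/

universe uK

lemma IsKnutson.step {K : Type uK} [Field K] {m n : ℕ} {f : MvPolynomial (Fin m × Fin n) K}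
    {I P : Ideal (MvPolynomial (Fin m × Fin n) K)} (hI : IsKnutson f I) (hIP : I ≤ P)
    (hP : P.IsPrime) (g : MvPolynomial (Fin m × Fin n) K) (hg : g ∉ P)
    (h : ∀ (R : Type uK) [CommRing R] (θ : MvPolynomial (Fin m × Fin n) K →+* R),
      I ≤ RingHom.ker θ → IsUnit (θ g) → P ≤ RingHom.ker θ) : IsKnutson f P := by
  classical
  have h1 : ∀ p ∈ P, ∃ N : ℕ, g ^ N * p ∈ I := by
    intro p hp
    let gb : MvPolynomial (Fin m × Fin n) K ⧸ I := Ideal.Quotient.mk I g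
    have h2 := h (Localization.Away gb)
      ((algebraMap (MvPolynomial (Fin m × Fin n) K ⧸ I) (Localization.Away gb)).comp
        (Ideal.Quotient.mk I)) (by
        intro x hx
        rw [RingHom.mem_ker, RingHom.comp_apply, Ideal.Quotient.eq_zero_iff_mem.2 hx, map_zero])
      (IsLocalization.Away.algebraMap_isUnit gb) hp
    rw [RingHom.mem_ker, RingHom.comp_apply,
      IsLocalization.map_eq_zero_iff (Submonoid.powers gb)] at h2
    obtain ⟨⟨_, N, rfl⟩, hN⟩ := h2
    refine ⟨N, ?_⟩
    rw [← Ideal.Quotient.eq_zero_iff_mem, map_mul, map_pow]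
    exact hN
  have h2 : ∃ N : ℕ, ∀ p ∈ P, g ^ N * p ∈ I := by
    obtain ⟨T, hT⟩ := (isNoetherianRing_iff_ideal_fg _).1 inferInstance P
    have h3 : ∀ p : T, ∃ N : ℕ, g ^ N * p.1 ∈ I := fun p =>
      h1 _ (by rw [← hT]; exact Ideal.subset_span p.2)
    choose N hN using h3
    refine ⟨∑ p : T, N p, fun p hp => ?_⟩
    rw [← hT] at hp
    refine Submodule.span_induction (p := fun x _ => g ^ (∑ p : T, N p) * x ∈ I) ?_ ?_ ?_ ?_ hp
    · intro x hx
      rw [← Finset.add_sum_erase _ _ (Finset.mem_univ (⟨x, hx⟩ : T)), add_comm, pow_add, mul_assoc]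
      exact Ideal.mul_mem_left _ _ (hN ⟨x, hx⟩)
    · simp
    · intro x y _ _ hx hy
      rw [mul_add]
      exact Ideal.add_mem _ hx hy
    · intro a x _ hx
      rw [smul_eq_mul, mul_left_comm]
      exact Ideal.mul_mem_left _ _ hx
  obtain ⟨N, hN⟩ := h2
  have e : I.colon (Ideal.span {g ^ N} : Ideal (MvPolynomial (Fin m × Fin n) K)) = P := by
    ext p
    rw [Ideal.mem_colon_span_singleton]
    constructor
    · intro hp
      exact (hP.mem_or_mem (hIP hp)).resolve_right fun hh => hg (hP.mem_of_pow_mem _ hh)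
    · intro hp
      rw [mul_comm]
      exact hN p hp
  rw [← e]
  exact IsKnutson.colon _ _ hI

/-- The partial permutation matrix. -/
lemma partialPerm {R : Type*} [CommRing R] {s m n : ℕ} (r : Fin s → Fin m)
    (c : Fin s → Fin n) (hr : Function.Injective r) (hc : Function.Injective c) :
    ∃ E : Matrix (Fin m) (Fin n) R, (E.submatrix r c).det = 1 ∧
      ∀ (t : ℕ) (A : Set (Fin m)) (B : Set (Fin n)) (T : Finset (Fin s)),
        (∀ k, r k ∈ A → c k ∈ B → k ∈ T) → T.card < t → MV E t A B := by
  classical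
  refine ⟨of fun i j => if ∃ k, r k = i ∧ c k = j then 1 else 0, ?_, ?_⟩
  · refine Eq.trans (congrArg det ?_) (det_one (n := Fin s) (R := R))
    ext i j
    simp only [submatrix_apply, of_apply, one_apply]
    refine if_congr ⟨?_, ?_⟩ rfl rfl
    · rintro ⟨k, h1, h2⟩
      rw [← hr h1, ← hc h2]
    · rintro rfl
      exact ⟨_, rfl, rfl⟩
  · intro t A B T hT hcard ρ κ hρ hκ
    have e : (of fun i j => if ∃ k, r k = i ∧ c k = j then (1 : R) else 0).submatrix ρ κ =
        (of fun (i : Fin t) (k : T) => if r k = ρ i then (1 : R) else 0) *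
        (of fun (k : T) (j : Fin t) => if c k = κ j then (1 : R) else 0) := by
      refine Matrix.ext fun i j => ?_
      rw [Matrix.mul_apply]
      simp only [submatrix_apply, of_apply]
      by_cases h : ∃ k, r k = ρ i ∧ c k = κ j
      · rw [if_pos h]
        obtain ⟨k, h1, h2⟩ := h
        have hk : k ∈ T := hT k (h1 ▸ hρ i) (h2 ▸ hκ j)
        rw [Finset.sum_eq_single ⟨k, hk⟩]
        · simp [h1, h2]
        · intro b _ hb
          rw [if_neg, zero_mul]
          intro h3
          exact hb (Subtype.ext (hr (h3.trans h1.symm)))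
        · simp
      · rw [if_neg h, eq_comm]
        refine Finset.sum_eq_zero fun k _ => ?_
        by_cases h1 : r k = ρ i
        · rw [if_neg (fun h2 => h ⟨k, h1, h2⟩), mul_zero]
        · rw [if_neg h1, zero_mul]
    rw [e]
    exact det_mul_zero_of_card_lt (by simpa using hcard) _ _

lemma genX_map_eval {K : Type*} [Field K] {m n : ℕ} (E : Matrix (Fin m) (Fin n) K) :
    (genX K m n).map (MvPolynomial.eval fun x : Fin m × Fin n => E x.1 x.2) = E := by
  ext i j
  simp [genX]

lemma map_minor {K R : Type*} [Field K] [CommRing R] {s m n : ℕ}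
    (θ : MvPolynomial (Fin m × Fin n) K →+* R) (r : Fin s → Fin m) (c : Fin s → Fin n) :
    θ ((genX K m n).submatrix r c).det = (((genX K m n).map θ).submatrix r c).det := by
  rw [RingHom.map_det]
  rfl

lemma det_notMem {K : Type*} [Field K] {s m n t r1 r2 c1 c2 : ℕ} (r : Fin s → Fin m)
    (c : Fin s → Fin n) (hr : Function.Injective r) (hc : Function.Injective c)
    (T : Finset (Fin s)) (hT : ∀ k, r k ∈ iv m r1 r2 → c k ∈ iv n c1 c2 → k ∈ T)
    (hcard : T.card < t) :
    ((genX K m n).submatrix r c).det ∉ genMinors K m n t r1 r2 c1 c2 := by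
  intro h
  obtain ⟨E, h1, h2⟩ := partialPerm (R := K) r c hr hc
  have h3 := h2 t _ _ T hT hcard
  have h4 := (genMinors_le_ker_iff (K := K) (r1 := r1) (r2 := r2) (c1 := c1) (c2 := c2)
    (MvPolynomial.eval fun x : Fin m × Fin n => E x.1 x.2)).2 (by rwa [genX_map_eval]) h
  rw [RingHom.mem_ker, map_minor, genX_map_eval, h1] at h4
  exact one_ne_zero h4

lemma minor_ne_zero {K : Type*} [Field K] {s m n : ℕ} (r : Fin s → Fin m)
    (c : Fin s → Fin n) (hr : Function.Injective r) (hc : Function.Injective c) :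
    ((genX K m n).submatrix r c).det ≠ 0 := by
  intro h
  obtain ⟨E, h1, -⟩ := partialPerm (R := K) r c hr hc
  have h4 := map_minor (MvPolynomial.eval fun x : Fin m × Fin n => E x.1 x.2) r c
  rw [genX_map_eval, h1, h, map_zero] at h4
  exact zero_ne_one h4

lemma step_gen {K : Type uK} [Field K] {m n : ℕ} {f : MvPolynomial (Fin m × Fin n) K} (hn : 0 < n)
    {t r1 r2 c1 c2 ta ra ra' ca ca' tb rb rb' cb cb' : ℕ} (ht : 1 ≤ t)
    (h1 : IsKnutson f (genMinors K m n ta ra ra' ca ca'))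
    (h2 : IsKnutson f (genMinors K m n tb rb rb' cb cb'))
    {s : ℕ} (r : Fin s → Fin m) (c : Fin s → Fin n) (hr : Function.Injective r)
    (hc : Function.Injective c)
    (T : Finset (Fin s)) (hT : ∀ k, r k ∈ iv m r1 r2 → c k ∈ iv n c1 c2 → k ∈ T)
    (hcard : T.card < t)
    (hle1 : ∀ (R : Type uK) [CommRing R] (M : Matrix (Fin m) (Fin n) R),
      MV M t (iv m r1 r2) (iv n c1 c2) → MV M ta (iv m ra ra') (iv n ca ca'))
    (hle2 : ∀ (R : Type uK) [CommRing R] (M : Matrix (Fin m) (Fin n) R),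
      MV M t (iv m r1 r2) (iv n c1 c2) → MV M tb (iv m rb rb') (iv n cb cb'))
    (key : ∀ (R : Type uK) [CommRing R] (M : Matrix (Fin m) (Fin n) R),
      MV M ta (iv m ra ra') (iv n ca ca') → MV M tb (iv m rb rb') (iv n cb cb') →
      IsUnit (M.submatrix r c).det → MV M t (iv m r1 r2) (iv n c1 c2)) :
    IsKnutson f (genMinors K m n t r1 r2 c1 c2) := by
  have hP : genMinors K m n t r1 r2 c1 c2 =
      RingHom.ker (Ideal.Quotient.mk (genMinors K m n t r1 r2 c1 c2)) := Ideal.mk_ker.symm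
  refine IsKnutson.step (IsKnutson.add _ _ h1 h2) ?_ (genMinors_isPrime hn ht) _
    (det_notMem r c hr hc T hT hcard) ?_
  · have h3 := (genMinors_le_ker_iff _).1 hP.le
    refine sup_le ?_ ?_
    · rw [hP]
      exact (genMinors_le_ker_iff _).2 (hle1 _ _ h3)
    · rw [hP]
      exact (genMinors_le_ker_iff _).2 (hle2 _ _ h3)
  · intro R _ θ hθ hu
    rw [genMinors_le_ker_iff]
    rw [map_minor] at hu
    exact key _ _ ((genMinors_le_ker_iff _).1 (le_sup_left.trans hθ))
      ((genMinors_le_ker_iff _).1 (le_sup_right.trans hθ)) hu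

/-! ### the individual steps -/

section steps
variable {K : Type uK} [Field K] {m n : ℕ} {f : MvPolynomial (Fin m × Fin n) K} {t r1 r2 c1 c2 : ℕ}

lemma iv_mono {N a b a' b' : ℕ} (h1 : a' ≤ a) (h2 : b ≤ b') : iv N a b ⊆ iv N a' b' := by
  intro i hi
  simp only [iv, Set.mem_ofPred_eq] at hi ⊢
  omega

lemma iv_insert_right {N a b : ℕ} (q : Fin N) (h : q.val + 1 = b) :
    iv N a b ⊆ insert q (iv N a (b - 1)) := by
  intro i hi
  simp only [iv, Set.mem_ofPred_eq, Set.mem_insert_iff, Fin.ext_iff] at hi ⊢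
  omega

lemma iv_insert_left {N a b : ℕ} (q : Fin N) (h : q.val + 1 = a) :
    iv N a b ⊆ insert q (iv N (a + 1) b) := by
  intro i hi
  simp only [iv, Set.mem_ofPred_eq, Set.mem_insert_iff, Fin.ext_iff] at hi ⊢
  omega

lemma stepA_CC (hn : 0 < n) (ht : 1 ≤ t) (hr1 : 1 ≤ r1) (hr2 : r2 ≤ m) (hc1 : 1 ≤ c1) (hc2 : c2 ≤ n)
    (hrt : r1 + t ≤ r2 + 1) (hct : c1 + t ≤ c2)
    (h1 : IsKnutson f (genMinors K m n t r1 r2 (c1 + 1) c2))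
    (h2 : IsKnutson f (genMinors K m n t r1 r2 c1 (c2 - 1))) :
    IsKnutson f (genMinors K m n t r1 r2 c1 c2) := by
  obtain ⟨s, rfl⟩ := Nat.exists_eq_add_of_le' ht
  refine step_gen hn ht h1 h2 (s := s) (fun k => ⟨r1 - 1 + k, by omega⟩)
    (fun k => ⟨c1 + k, by omega⟩) (fun a b h => ?_) (fun a b h => ?_) Finset.univ (by simp) (by simp)
    (fun R _ M h => h.mono (iv_mono le_rfl le_rfl) (iv_mono (by omega) (by omega)))
    (fun R _ M h => h.mono (iv_mono le_rfl le_rfl) (iv_mono (by omega) (by omega)))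
    (fun R _ M ha hb hu => (MV.key_col ha hb _ _ (fun k => ?_) (fun k => ?_) (fun k => ?_) hu
      ⟨c2 - 1, by omega⟩ ?_ subset_rfl).mono subset_rfl (iv_insert_right _ ?_)) <;>
    simp only [Fin.ext_iff, iv, Set.mem_ofPred_eq] at * <;> omega

lemma stepA_RC (hn : 0 < n) (ht : 1 ≤ t) (hr1 : 2 ≤ r1) (hr2 : r2 ≤ m) (hc1 : 1 ≤ c1) (hc2 : c2 ≤ n)
    (hrt : r1 + t ≤ r2 + 1) (hct : c1 + t ≤ c2)
    (h1 : IsKnutson f (genMinors K m n (t + 1) (r1 - 1) r2 c1 c2))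
    (h2 : IsKnutson f (genMinors K m n t r1 r2 c1 (c2 - 1))) :
    IsKnutson f (genMinors K m n t r1 r2 c1 c2) := by
  refine step_gen hn ht h1 h2 (s := t) (fun k => ⟨r1 - 2 + k, by omega⟩)
    (fun k => ⟨c1 - 1 + k, by omega⟩) (fun a b h => ?_) (fun a b h => ?_)
    (Finset.univ.erase ⟨0, by omega⟩) (fun k hk _ => ?_) ?_
    (fun R _ M h => (h.succ_insert ⟨r1 - 2, by omega⟩).mono ?_ subset_rfl)
    (fun R _ M h => h.mono (iv_mono le_rfl le_rfl) (iv_mono (by omega) (by omega)))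
    (fun R _ M ha hb hu => (MV.key_col ha hb _ _ (fun k => ?_) (fun k => ?_) (fun k => ?_) hu
      ⟨c2 - 1, by omega⟩ ?_ (iv_mono (by omega) le_rfl)).mono subset_rfl (iv_insert_right _ ?_))
  case refine_4 => simp; omega
  case refine_5 =>
    have := iv_insert_left (N := m) (a := r1 - 1) (b := r2) ⟨r1 - 2, by omega⟩ (by simp; omega)
    rwa [show r1 - 1 + 1 = r1 by omega] at this
  all_goals
    simp only [Fin.ext_iff, iv, Set.mem_ofPred_eq, Finset.mem_erase, Finset.mem_univ, ne_eq, and_true] at *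
    omega

lemma stepA_CR (hn : 0 < n) (ht : 1 ≤ t) (hr1 : 1 ≤ r1) (hr2 : r2 + 1 ≤ m) (hc1 : 1 ≤ c1)
    (hc2 : c2 ≤ n) (hrt : r1 + t ≤ r2 + 1) (hct : c1 + t ≤ c2)
    (h1 : IsKnutson f (genMinors K m n (t + 1) r1 (r2 + 1) c1 c2))
    (h2 : IsKnutson f (genMinors K m n t r1 r2 (c1 + 1) c2)) :
    IsKnutson f (genMinors K m n t r1 r2 c1 c2) := by
  refine step_gen hn ht h1 h2 (s := t) (fun k => ⟨r2 + 1 - t + k, by omega⟩)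
    (fun k => ⟨c1 + k, by omega⟩) (fun a b h => ?_) (fun a b h => ?_)
    (Finset.univ.erase ⟨t - 1, by omega⟩) (fun k hk _ => ?_) ?_
    (fun R _ M h => (h.succ_insert ⟨r2, by omega⟩).mono ?_ subset_rfl)
    (fun R _ M h => h.mono (iv_mono le_rfl le_rfl) (iv_mono (by omega) (by omega)))
    (fun R _ M ha hb hu => (MV.key_col ha hb _ _ (fun k => ?_) (fun k => ?_) (fun k => ?_) hu
      ⟨c1 - 1, by omega⟩ ?_ (iv_mono (by omega) (by omega))).mono subset_rfl (iv_insert_left _ ?_))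
  case refine_4 => simp; omega
  case refine_5 =>
    exact iv_insert_right (N := m) (a := r1) (b := r2 + 1) ⟨r2, by omega⟩ (by simp)
  all_goals
    simp only [Fin.ext_iff, iv, Set.mem_ofPred_eq, Finset.mem_erase, Finset.mem_univ, ne_eq, and_true] at *
    omega

lemma stepA_RR (hn : 0 < n) (ht : 1 ≤ t) (hr1 : 2 ≤ r1) (hr2 : r2 + 1 ≤ m) (hc1 : 1 ≤ c1)
    (hc2 : c2 ≤ n) (hrt : r1 + t ≤ r2 + 1) (hct : c1 + t ≤ c2)
    (h1 : IsKnutson f (genMinors K m n (t + 1) (r1 - 1) r2 c1 c2))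
    (h2 : IsKnutson f (genMinors K m n (t + 1) r1 (r2 + 1) c1 c2)) :
    IsKnutson f (genMinors K m n t r1 r2 c1 c2) := by
  have e1 : iv m (r1 - 1) r2 = insert ⟨r1 - 2, by omega⟩ (iv m r1 r2) := by
    ext i
    simp only [iv, Set.mem_ofPred_eq, Set.mem_insert_iff, Fin.ext_iff]
    omega
  have e2 : iv m r1 (r2 + 1) = insert ⟨r2, by omega⟩ (iv m r1 r2) := by
    ext i
    simp only [iv, Set.mem_ofPred_eq, Set.mem_insert_iff, Fin.ext_iff]
    omega
  refine step_gen hn ht h1 h2 (s := t + 1)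
    (fun k => ⟨if k.val = t then r2 else r1 - 2 + k, by split_ifs <;> omega⟩)
    (fun k => ⟨c1 - 1 + k, by omega⟩) (fun a b h => ?_) (fun a b h => ?_)
    ((Finset.univ.erase ⟨0, by omega⟩).erase ⟨t, by omega⟩) (fun k hk _ => ?_) ?_
    (fun R _ M h => e1 ▸ h.succ_insert _)
    (fun R _ M h => e2 ▸ h.succ_insert _)
    (fun R _ M ha hb hu => MV.key_two_row _ _ (e1 ▸ ha) (e2 ▸ hb) _ _ ⟨0, by omega⟩ ⟨t, by omega⟩
      ?_ ?_ ?_ (fun k hk1 hk2 => ?_) (fun k => ?_) hu)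
  case refine_4 =>
    rw [Finset.card_erase_of_mem, Finset.card_erase_of_mem]
    · simp; omega
    · simp
    · simp; omega
  all_goals
    simp only [Fin.ext_iff, iv, Set.mem_ofPred_eq, Finset.mem_erase, Finset.mem_univ, ne_eq, and_true] at *
    try split_ifs at *
  all_goals omega

lemma stepB_RC (hn : 0 < n) (ht : 1 ≤ t) (hr1 : 1 ≤ r1) (hr2 : r2 ≤ m) (hc1 : 1 ≤ c1)
    (hc2 : c2 + 1 ≤ n) (hrt : r1 + t ≤ r2) (hct : c1 + t ≤ c2 + 1)
    (h1 : IsKnutson f (genMinors K m n (t + 1) r1 r2 c1 (c2 + 1)))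
    (h2 : IsKnutson f (genMinors K m n t (r1 + 1) r2 c1 c2)) :
    IsKnutson f (genMinors K m n t r1 r2 c1 c2) := by
  refine step_gen hn ht h1 h2 (s := t) (fun k => ⟨r1 + k, by omega⟩)
    (fun k => ⟨c2 + 1 - t + k, by omega⟩) (fun a b h => ?_) (fun a b h => ?_)
    (Finset.univ.erase ⟨t - 1, by omega⟩) (fun k _ hk => ?_) ?_
    (fun R _ M h => (h.transpose.succ_insert ⟨c2, by omega⟩).transpose.mono subset_rfl ?_)
    (fun R _ M h => h.mono (iv_mono (by omega) (by omega)) (iv_mono le_rfl le_rfl))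
    (fun R _ M ha hb hu => (MV.key_row ha hb _ _ (fun k => ?_) (fun k => ?_) (fun k => ?_) hu
      ⟨r1 - 1, by omega⟩ ?_ (iv_mono (by omega) (by omega))).mono (iv_insert_left _ ?_) subset_rfl)
  case refine_4 => simp; omega
  case refine_5 =>
    exact iv_insert_right (N := n) (a := c1) (b := c2 + 1) ⟨c2, by omega⟩ (by simp)
  all_goals
    simp only [Fin.ext_iff, iv, Set.mem_ofPred_eq, Finset.mem_erase, Finset.mem_univ, ne_eq, and_true] at *
    omega

lemma stepB_CR (hn : 0 < n) (ht : 1 ≤ t) (hr1 : 1 ≤ r1) (hr2 : r2 ≤ m) (hc1 : 2 ≤ c1)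
    (hc2 : c2 ≤ n) (hrt : r1 + t ≤ r2) (hct : c1 + t ≤ c2 + 1)
    (h1 : IsKnutson f (genMinors K m n (t + 1) r1 r2 (c1 - 1) c2))
    (h2 : IsKnutson f (genMinors K m n t r1 (r2 - 1) c1 c2)) :
    IsKnutson f (genMinors K m n t r1 r2 c1 c2) := by
  refine step_gen hn ht h1 h2 (s := t) (fun k => ⟨r1 - 1 + k, by omega⟩)
    (fun k => ⟨c1 - 2 + k, by omega⟩) (fun a b h => ?_) (fun a b h => ?_)
    (Finset.univ.erase ⟨0, by omega⟩) (fun k _ hk => ?_) ?_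
    (fun R _ M h => (h.transpose.succ_insert ⟨c1 - 2, by omega⟩).transpose.mono subset_rfl ?_)
    (fun R _ M h => h.mono (iv_mono (by omega) (by omega)) (iv_mono le_rfl le_rfl))
    (fun R _ M ha hb hu => (MV.key_row ha hb _ _ (fun k => ?_) (fun k => ?_) (fun k => ?_) hu
      ⟨r2 - 1, by omega⟩ ?_ (iv_mono (by omega) (by omega))).mono (iv_insert_right _ ?_) subset_rfl)
  case refine_4 => simp; omega
  case refine_5 =>
    have := iv_insert_left (N := n) (a := c1 - 1) (b := c2) ⟨c1 - 2, by omega⟩ (by simp; omega)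
    rwa [show c1 - 1 + 1 = c1 by omega] at this
  all_goals
    simp only [Fin.ext_iff, iv, Set.mem_ofPred_eq, Finset.mem_erase, Finset.mem_univ, ne_eq, and_true] at *
    omega

lemma stepB_CC (hn : 0 < n) (ht : 1 ≤ t) (hr1 : 1 ≤ r1) (hr2 : r2 ≤ m) (hc1 : 2 ≤ c1)
    (hc2 : c2 + 1 ≤ n) (hrt : r1 + t ≤ r2) (hct : c1 + t ≤ c2 + 1)
    (h1 : IsKnutson f (genMinors K m n (t + 1) r1 r2 (c1 - 1) c2))
    (h2 : IsKnutson f (genMinors K m n (t + 1) r1 r2 c1 (c2 + 1))) :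
    IsKnutson f (genMinors K m n t r1 r2 c1 c2) := by
  have e1 : iv n (c1 - 1) c2 = insert ⟨c1 - 2, by omega⟩ (iv n c1 c2) := by
    ext i
    simp only [iv, Set.mem_ofPred_eq, Set.mem_insert_iff, Fin.ext_iff]
    omega
  have e2 : iv n c1 (c2 + 1) = insert ⟨c2, by omega⟩ (iv n c1 c2) := by
    ext i
    simp only [iv, Set.mem_ofPred_eq, Set.mem_insert_iff, Fin.ext_iff]
    omega
  refine step_gen hn ht h1 h2 (s := t + 1)
    (fun k => ⟨r1 - 1 + k, by omega⟩)
    (fun k => ⟨if k.val = t then c2 else c1 - 2 + k, by split_ifs <;> omega⟩)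
    (fun a b h => ?_) (fun a b h => ?_)
    ((Finset.univ.erase ⟨0, by omega⟩).erase ⟨t, by omega⟩) (fun k _ hk => ?_) ?_
    (fun R _ M h => e1 ▸ (h.transpose.succ_insert _).transpose)
    (fun R _ M h => e2 ▸ (h.transpose.succ_insert _).transpose)
    (fun R _ M ha hb hu => MV.key_two_col _ _ (e1 ▸ ha) (e2 ▸ hb) _ _ ⟨0, by omega⟩ ⟨t, by omega⟩
      ?_ ?_ ?_ (fun k => ?_) (fun k hk1 hk2 => ?_) hu)
  case refine_4 =>
    rw [Finset.card_erase_of_mem, Finset.card_erase_of_mem]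
    · simp; omega
    · simp
    · simp; omega
  all_goals
    simp only [Fin.ext_iff, iv, Set.mem_ofPred_eq, Finset.mem_erase, Finset.mem_univ, ne_eq, and_true] at *
    try split_ifs at *
  all_goals omega

end steps

/-! ### the base case and the induction -/

lemma IsKnutson.factor {K : Type*} [Field K] {m n : ℕ} {f g : MvPolynomial (Fin m × Fin n) K}
    (hf : f ≠ 0) (hg : g ∣ f) : IsKnutson f (Ideal.span {g}) := by
  obtain ⟨h, rfl⟩ := hg
  have hh : h ≠ 0 := right_ne_zero_of_mul hf
  have e : (Ideal.span {g * h}).colon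
      (Ideal.span {h} : Ideal (MvPolynomial (Fin m × Fin n) K)) = Ideal.span {g} := by
    ext p
    rw [Ideal.mem_colon_span_singleton, Ideal.mem_span_singleton, Ideal.mem_span_singleton]
    exact mul_dvd_mul_iff_right hh
  rw [← e]
  exact IsKnutson.colon _ _ IsKnutson.base

lemma strictMono_gap {t N : ℕ} (r : Fin t → Fin N) (hr : StrictMono r) :
    ∀ (d : ℕ) (k l : Fin t), l.val = k.val + d → (r k).val + d ≤ (r l).val := by
  intro d
  induction d with
  | zero =>
    intro k l h
    have : l = k := Fin.ext (by omega)
    rw [this]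
    simp
  | succ d ih =>
    intro k l h
    have h1 := ih k ⟨k.val + d, by omega⟩ rfl
    have h2 : r ⟨k.val + d, by omega⟩ < r l := hr (Fin.lt_def.2 (by simp; omega))
    have h3 := Fin.lt_def.1 h2
    omega

lemma strictMono_interval {t N a b : ℕ} (r : Fin t → Fin N) (hr : StrictMono r)
    (hab : b + 1 = a + t) (h : ∀ i, a ≤ (r i).val + 1 ∧ (r i).val + 1 ≤ b) (k : Fin t) :
    (r k).val = a - 1 + k.val := by
  have hk := k.isLt
  have h1 := strictMono_gap r hr k.val ⟨0, by omega⟩ k (by simp)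
  have h2 := strictMono_gap r hr (t - 1 - k.val) k ⟨t - 1, by omega⟩ (by simp; omega)
  have h3 := h ⟨0, by omega⟩
  have h4 := h ⟨t - 1, by omega⟩
  omega

lemma genMinors_block {K : Type*} [Field K] {m n t r1 r2 c1 c2 : ℕ} (hr1 : 1 ≤ r1) (hc1 : 1 ≤ c1)
    (hrt : r2 + 1 = r1 + t) (hct : c2 + 1 = c1 + t)
    (r : Fin t → Fin m) (c : Fin t → Fin n) (hr : ∀ k, (r k).val = r1 - 1 + k.val)
    (hc : ∀ k, (c k).val = c1 - 1 + k.val) :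
    genMinors K m n t r1 r2 c1 c2 = Ideal.span {((genX K m n).submatrix r c).det} := by
  unfold genMinors
  congr 1
  ext p
  constructor
  · rintro ⟨r', c', h1, h2, h3, h4, rfl⟩
    have e1 : r' = r := by
      funext k
      exact Fin.ext ((strictMono_interval r' h1 hrt h3 k).trans (hr k).symm)
    have e2 : c' = c := by
      funext k
      exact Fin.ext ((strictMono_interval c' h2 hct h4 k).trans (hc k).symm)
    rw [e1, e2]
    rfl
  · rintro rfl
    refine ⟨r, c, fun a b h => ?_, fun a b h => ?_, fun k => ?_, fun k => ?_, rfl⟩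
    · rw [Fin.lt_def, hr, hr]
      have := Fin.lt_def.1 h
      omega
    · rw [Fin.lt_def, hc, hc]
      have := Fin.lt_def.1 h
      omega
    · rw [hr]; omega
    · rw [hc]; omega

lemma knutsonF_ne_zero {K : Type*} [Field K] {m n : ℕ} (hm : 0 < m) (hmn : m < n) :
    knutsonF K m n hm hmn ≠ 0 := by
  unfold knutsonF
  refine mul_ne_zero (Finset.prod_ne_zero_iff.2 fun k _ => mul_ne_zero ?_ ?_)
    (Finset.prod_ne_zero_iff.2 fun k _ => ?_) <;>
  · refine minor_ne_zero (fun i => ⟨_, _⟩) (fun j => ⟨_, _⟩) (fun a b h => ?_) (fun a b h => ?_) <;>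
    simp only [Fin.ext_iff] at h ⊢ <;> omega

lemma knutson_base {K : Type*} [Field K] {m n t r1 r2 c1 c2 : ℕ} (hm : 0 < m) (hmn : m < n)
    (ht : 1 ≤ t) (hr1 : 1 ≤ r1) (hc1 : 1 ≤ c1) (hr2 : r2 ≤ m) (hc2 : c2 ≤ n)
    (hrt : r2 + 1 = r1 + t) (hct : c2 + 1 = c1 + t)
    (g1 : r1 = 1 ∨ c1 = 1) (g2 : r2 = m ∨ c2 = n) :
    IsKnutson (knutsonF K m n hm hmn) (genMinors K m n t r1 r2 c1 c2) := by
  by_cases htm : t = m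
  · subst htm
    rw [genMinors_block hr1 hc1 hrt hct (fun i => ⟨i.val, i.isLt⟩)
      (fun j => ⟨c1 - 1 + j.val, by omega⟩) (fun k => by simp; omega) (fun k => rfl)]
    refine IsKnutson.factor (knutsonF_ne_zero hm hmn) ?_
    unfold knutsonF
    refine Dvd.dvd.mul_left ?_ _
    refine Dvd.dvd.trans ?_ (Finset.dvd_prod_of_mem _
      (Finset.mem_univ (⟨c1 - 1, by omega⟩ : Fin (n - t + 1))))
    exact dvd_of_eq rfl
  · obtain ⟨s, rfl⟩ := Nat.exists_eq_add_of_le' ht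
    rcases (by omega : (r1 = 1 ∧ c2 = n) ∨ (c1 = 1 ∧ r2 = m)) with ⟨rfl, rfl⟩ | ⟨rfl, rfl⟩
    · rw [genMinors_block hr1 hc1 hrt hct (fun i => ⟨i.val, by omega⟩)
        (fun j => ⟨c2 - 1 - s + j.val, by omega⟩) (fun k => by simp) (fun k => by simp; omega)]
      refine IsKnutson.factor (knutsonF_ne_zero hm hmn) ?_
      unfold knutsonF
      refine Dvd.dvd.mul_right ?_ _
      refine Dvd.dvd.trans ?_ (Finset.dvd_prod_of_mem _
        (Finset.mem_univ (⟨s, by omega⟩ : Fin (m - 1))))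
      exact dvd_mul_left _ _
    · rw [genMinors_block hr1 hc1 hrt hct (fun i => ⟨r2 - 1 - s + i.val, by omega⟩)
        (fun j => ⟨j.val, by omega⟩) (fun k => by simp; omega) (fun k => by simp)]
      refine IsKnutson.factor (knutsonF_ne_zero hm hmn) ?_
      unfold knutsonF
      refine Dvd.dvd.mul_right ?_ _
      refine Dvd.dvd.trans ?_ (Finset.dvd_prod_of_mem _
        (Finset.mem_univ (⟨s, by omega⟩ : Fin (r2 - 1))))
      exact dvd_mul_right _ _

lemma knutson_main {K : Type*} [Field K] {m n : ℕ} (hm : 0 < m) (hmn : m < n) :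
    ∀ (N t r1 r2 c1 c2 : ℕ), 1 ≤ t → 1 ≤ r1 → 1 ≤ c1 → r2 ≤ m → c2 ≤ n →
      r1 + t ≤ r2 + 1 → c1 + t ≤ c2 + 1 → (r1 = 1 ∨ c1 = 1) → (r2 = m ∨ c2 = n) →
      r2 + c2 + 2 = r1 + c1 + 2 * t + N →
      IsKnutson (knutsonF K m n hm hmn) (genMinors K m n t r1 r2 c1 c2) := by
  intro N
  induction N using Nat.strong_induction_on with
  | _ N ih =>
  intro t r1 r2 c1 c2 ht hr1 hc1 hr2 hc2 hrt hct g1 g2 hN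
  have hn : 0 < n := by omega
  by_cases hcol : c1 + t ≤ c2
  · by_cases h1 : r1 = 1 <;> by_cases h2 : r2 = m
    · refine stepA_CC hn ht hr1 hr2 hc1 hc2 hrt hcol (ih (N - 1) ?_ _ _ _ _ _ ?_ ?_ ?_ ?_ ?_ ?_ ?_ ?_ ?_ ?_)
        (ih (N - 1) ?_ _ _ _ _ _ ?_ ?_ ?_ ?_ ?_ ?_ ?_ ?_ ?_ ?_) <;> omega
    · refine stepA_CR hn ht hr1 (by omega) hc1 hc2 hrt hcol (ih (N - 1) ?_ _ _ _ _ _ ?_ ?_ ?_ ?_ ?_ ?_ ?_ ?_ ?_ ?_)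
        (ih (N - 1) ?_ _ _ _ _ _ ?_ ?_ ?_ ?_ ?_ ?_ ?_ ?_ ?_ ?_) <;> omega
    · refine stepA_RC hn ht (by omega) hr2 hc1 hc2 hrt hcol (ih (N - 1) ?_ _ _ _ _ _ ?_ ?_ ?_ ?_ ?_ ?_ ?_ ?_ ?_ ?_)
        (ih (N - 1) ?_ _ _ _ _ _ ?_ ?_ ?_ ?_ ?_ ?_ ?_ ?_ ?_ ?_) <;> omega
    · refine stepA_RR hn ht (by omega) (by omega) hc1 hc2 hrt hcol (ih (N - 1) ?_ _ _ _ _ _ ?_ ?_ ?_ ?_ ?_ ?_ ?_ ?_ ?_ ?_)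
        (ih (N - 1) ?_ _ _ _ _ _ ?_ ?_ ?_ ?_ ?_ ?_ ?_ ?_ ?_ ?_) <;> omega
  by_cases hrow : r1 + t ≤ r2
  · by_cases h1 : c1 = 1 <;> by_cases h2 : c2 = n
    · omega
    · refine stepB_RC hn ht hr1 hr2 hc1 (by omega) hrow hct (ih (N - 1) ?_ _ _ _ _ _ ?_ ?_ ?_ ?_ ?_ ?_ ?_ ?_ ?_ ?_)
        (ih (N - 1) ?_ _ _ _ _ _ ?_ ?_ ?_ ?_ ?_ ?_ ?_ ?_ ?_ ?_) <;> omega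
    · refine stepB_CR hn ht hr1 hr2 (by omega) hc2 hrow hct (ih (N - 1) ?_ _ _ _ _ _ ?_ ?_ ?_ ?_ ?_ ?_ ?_ ?_ ?_ ?_)
        (ih (N - 1) ?_ _ _ _ _ _ ?_ ?_ ?_ ?_ ?_ ?_ ?_ ?_ ?_ ?_) <;> omega
    · refine stepB_CC hn ht hr1 hr2 (by omega) (by omega) hrow hct (ih (N - 1) ?_ _ _ _ _ _ ?_ ?_ ?_ ?_ ?_ ?_ ?_ ?_ ?_ ?_)
        (ih (N - 1) ?_ _ _ _ _ _ ?_ ?_ ?_ ?_ ?_ ?_ ?_ ?_ ?_ ?_) <;> omega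
  exact knutson_base hm hmn ht hr1 hc1 hr2 hc2 (by omega) (by omega) g1 g2

end KnutsonAux

/-- For every `1 ≤ t ≤ m` and row indices `1 ≤ a < b ≤ m` with `b - a + 1 ≥ t`,
the ideal `I_t(X^{[a,b]})` of `t`-minors on rows `a, …, b` belongs to `C_f`. -/
theorem determinantal_rows_isKnutson (K : Type*) [Field K] (m n : ℕ)
    (hm : 0 < m) (hmn : m < n) (t : ℕ) (ht1 : 1 ≤ t) (htm : t ≤ m)
    (a b : ℕ) (ha : 1 ≤ a) (hab : a < b) (hb : b ≤ m) (hw : t ≤ b - a + 1) :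
    IsKnutson (knutsonF K m n hm hmn) (genMinors K m n t a b 1 n) := by
  exact knutson_main hm hmn (b + n + 2 - (a + 1 + 2 * t)) t a b 1 n ht1 ha le_rfl hb le_rfl (by omega) (by omega) (Or.inr rfl)
    (Or.inr rfl) (by omega)
end

section
/- Let K be a field, m < n positive integers, and f = (∏_{k=0}^{m-2} det(X_{[1,k+1]}^{[m-k,m]}) · det(X_{[n-k,n]}^{[1,k+1]})) · ∏_{k=1}^{n-m+1} det(X_{[k,m+k-1]}) in S = K[x_{ij}]. Fix t with 1 ≤ t ≤ m. Then for every i = 1,...,n−t+1, the ideal I_t(X_{[i,t+i−1]}) generated by the t×t minors of the submatrix of X on the t adjacent columns i, i+1, ..., t+i−1 belongs to C_f. -/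
namespace KnutsonAux

/-- The column `i0 + j`. -/
def colf {n q i0 : ℕ} (h : i0 + (q + 1) ≤ n) (j : Fin (q + 1)) : Fin n := ⟨i0 + j.val, by omega⟩

theorem colf_inj {n q i0 : ℕ} (h : i0 + (q + 1) ≤ n) {a b : Fin (q + 1)}
    (hab : colf h a = colf h b) : a = b := by
  simp only [colf, Fin.mk.injEq] at hab
  ext; omega

/-- Ideal of maximal minors of the columns `i0, ..., i0 + q`. -/
noncomputable def PP (K : Type*) [Field K] (m : ℕ) {n q i0 : ℕ} (h : i0 + (q + 1) ≤ n) :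
    Ideal (MvPolynomial (Fin m × Fin n) K) :=
  Ideal.span { p | ∃ r : Fin (q + 1) → Fin m, StrictMono r ∧
    p = Matrix.det (Matrix.of fun i j => MvPolynomial.X (r i, colf h j)) }

theorem strictMono_forced {n q i0 : ℕ} (h : i0 + (q + 1) ≤ n) (c : Fin (q + 1) → Fin n)
    (hc : StrictMono c) (hb : ∀ j, i0 + 1 ≤ (c j).val + 1 ∧ (c j).val + 1 ≤ (q + 1) + (i0 + 1) - 1) :
    c = colf h := by
  have lo : ∀ k (hk : k < q + 1), i0 + k ≤ (c ⟨k, hk⟩).val := by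
    intro k
    induction k with
    | zero => intro hk; have := hb ⟨0, hk⟩; omega
    | succ k ih =>
      intro hk
      have h1 := ih (by omega)
      have h2 : c ⟨k, by omega⟩ < c ⟨k + 1, hk⟩ := hc (by simp [Fin.lt_def])
      rw [Fin.lt_def] at h2
      omega
  have hi : ∀ k (hk : k < q + 1), (c ⟨q - k, by omega⟩).val ≤ i0 + (q - k) := by
    intro k
    induction k with
    | zero => intro hk; have := hb ⟨q - 0, by omega⟩; omega
    | succ k ih =>
      intro hk
      have h1 := ih (by omega)
      have h2 : c ⟨q - (k + 1), by omega⟩ < c ⟨q - k, by omega⟩ := hc (by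
        simp only [Fin.lt_def]; omega)
      rw [Fin.lt_def] at h2
      omega
  funext j
  ext
  have h1 := lo j.val j.isLt
  have h2 := hi (q - j.val) (by omega)
  have h3 : q - (q - j.val) = j.val := by omega
  simp only [h3] at h2
  simp only [colf]
  simp only [Fin.eta] at h1 h2
  omega

theorem genMinors_eq (K : Type*) [Field K] (m : ℕ) {n q i0 : ℕ} (h : i0 + (q + 1) ≤ n) :
    genMinors K m n (q + 1) 1 m (i0 + 1) (q + 1 + (i0 + 1) - 1) = PP K m h := by
  unfold genMinors PP
  congr 1
  ext p
  constructor
  · rintro ⟨r, c, hr, hc, -, hb, rfl⟩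
    have := strictMono_forced h c hc hb
    subst this
    exact ⟨r, hr, rfl⟩
  · rintro ⟨r, hr, rfl⟩
    refine ⟨r, colf h, hr, ?_, ?_, ?_, rfl⟩
    · intro a b hab
      simp only [colf, Fin.lt_def] at *
      omega
    · intro i; have := (r i).isLt; omega
    · intro j; have := j.isLt; simp only [colf]; omega

/-- Generic matrix of rank at most `q` on the columns. -/
noncomputable def gen0 (K : Type*) [Field K] (m : ℕ) {n q i0 : ℕ} (h : i0 + (q + 1) ≤ n) :
    Fin m × Fin n → MvPolynomial ((Fin m × Fin n) ⊕ Fin q) K := fun p =>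
  if p.2.val = i0 then
    ∑ b : Fin q, MvPolynomial.X (Sum.inl (p.1, colf h b.succ)) * MvPolynomial.X (Sum.inr b)
  else MvPolynomial.X (Sum.inl p)

/-- The prime ideal of polynomials vanishing on that generic matrix. -/
noncomputable def QQ (K : Type*) [Field K] (m : ℕ) {n q i0 : ℕ} (h : i0 + (q + 1) ≤ n) :
    Ideal (MvPolynomial (Fin m × Fin n) K) :=
  RingHom.ker (MvPolynomial.aeval (gen0 K m h)).toRingHom

theorem QQ_prime (K : Type*) [Field K] (m : ℕ) {n q i0 : ℕ} (h : i0 + (q + 1) ≤ n) :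
    (QQ K m h).IsPrime := RingHom.ker_isPrime _

theorem mem_QQ (K : Type*) [Field K] (m : ℕ) {n q i0 : ℕ} (h : i0 + (q + 1) ≤ n)
    (F : MvPolynomial (Fin m × Fin n) K) :
    F ∈ QQ K m h ↔ MvPolynomial.aeval (gen0 K m h) F = 0 := Iff.rfl

theorem gen0_ker (K : Type*) [Field K] (m : ℕ) {n q i0 : ℕ} (h : i0 + (q + 1) ≤ n) (r : Fin m) :
    ∑ b, gen0 K m h (r, colf h b) *
      (Fin.cons (-1) (fun b => MvPolynomial.X (Sum.inr b)) : Fin (q + 1) → _) b = 0 := by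
  rw [Fin.sum_univ_succ]
  simp [gen0, colf]

theorem QQ_spec (K : Type*) [Field K] (m : ℕ) {n q i0 : ℕ} (h : i0 + (q + 1) ≤ n)
    {E : Type*} [CommRing E] [Algebra K E] (g : Fin m × Fin n → E) (u : Fin (q + 1) → E)
    (hu : u 0 = 1) (hk : ∀ r, ∑ b, g (r, colf h b) * u b = 0)
    (F : MvPolynomial (Fin m × Fin n) K) (hF : F ∈ QQ K m h) : MvPolynomial.aeval g F = 0 := by
  have key : (MvPolynomial.aeval (Sum.elim g (fun b : Fin q => - u b.succ))).comp
      (MvPolynomial.aeval (gen0 K m h)) = MvPolynomial.aeval (R := K) g := by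
    apply MvPolynomial.algHom_ext
    rintro ⟨r, c⟩
    simp only [AlgHom.comp_apply, MvPolynomial.aeval_X]
    unfold gen0
    split_ifs with hc
    · have hc' : c = colf h 0 := by ext; simpa [colf] using hc
      simp only [map_sum, map_mul, MvPolynomial.aeval_X, Sum.elim_inl, Sum.elim_inr]
      have := hk r
      rw [Fin.sum_univ_succ, hu, mul_one] at this
      rw [hc', eq_neg_of_add_eq_zero_left this]
      simp
    · simp
  rw [← key, AlgHom.comp_apply, (mem_QQ K m h F).1 hF, map_zero]

theorem PP_le_QQ (K : Type*) [Field K] (m : ℕ) {n q i0 : ℕ} (h : i0 + (q + 1) ≤ n) :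
    PP K m h ≤ QQ K m h := by
  unfold PP
  rw [Ideal.span_le]
  rintro p ⟨r, hr, rfl⟩
  rw [SetLike.mem_coe, mem_QQ, AlgHom.map_det, ← Matrix.exists_mulVec_eq_zero_iff]
  refine ⟨Fin.cons (-1) (fun b => MvPolynomial.X (Sum.inr b)), ?_, ?_⟩
  · intro h0
    have := congrFun h0 0
    simp at this
  · funext a
    have := gen0_ker K m h (r a)
    simpa [Matrix.mulVec, dotProduct] using this

/-- Standard exponents. -/
def Std {m n q i0 : ℕ} (h : i0 + (q + 1) ≤ n) : Set (Fin m × Fin n →₀ ℕ) :=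
  { w | ¬ ∃ r : Fin (q + 1) → Fin m, StrictMono r ∧ ∀ b, w (r b, colf h b) ≠ 0 }

/-- Auxiliary weight. -/
noncomputable def wt {m n : ℕ} : (Fin m × Fin n →₀ ℕ) →+ ℕ :=
  Finsupp.liftAddHom (fun p => AddMonoidHom.mulRight (p.1.val * p.2.val))

theorem wt_single {m n : ℕ} (p : Fin m × Fin n) (k : ℕ) :
    wt (Finsupp.single p k) = k * (p.1.val * p.2.val) := by
  simp [wt]

theorem prod_X_eq (K : Type*) [Field K] {m n q : ℕ} (p : Fin (q + 1) → Fin m × Fin n) :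
    ∏ b, (MvPolynomial.X (p b) : MvPolynomial (Fin m × Fin n) K) =
      MvPolynomial.monomial (∑ b, Finsupp.single (p b) 1) 1 := by
  rw [MvPolynomial.monomial_sum_one]
  rfl

theorem wt_perm_lt {m n q i0 : ℕ} (h : i0 + (q + 1) ≤ n) (r : Fin (q + 1) → Fin m)
    (hr : StrictMono r) (σ : Equiv.Perm (Fin (q + 1))) (hσ : σ ≠ 1) :
    wt (∑ b, Finsupp.single (r (σ b), colf h b) 1) < wt (∑ b, Finsupp.single (r b, colf h b) 1) := by
  simp only [map_sum, wt_single, one_mul]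
  have hm : Monovary (fun b => (r b).val) (fun b => (colf h b).val) := by
    intro a b hab
    simp only [colf] at hab
    exact hr.monotone (by rw [Fin.le_def]; omega)
  refine (hm.sum_comp_perm_mul_lt_sum_mul_iff (σ := σ)).2 ?_
  intro hmon
  apply hσ
  have : Monotone σ := by
    intro a b hab
    rcases hab.eq_or_lt with rfl | hab
    · exact le_rfl
    · have := @hmon a b (by simp only [colf]; rw [Fin.lt_def] at hab; omega)
      simp only [Function.comp] at this
      exact hr.le_iff_le.1 (by rw [Fin.le_def]; exact this)
  have hs : StrictMono σ := this.strictMono_of_injective σ.injective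
  ext b
  have e : (σ : Fin (q+1) → Fin (q+1)) = id := by
    have := Subsingleton.elim (StrictMono.orderIsoOfSurjective σ hs σ.surjective) (OrderIso.refl _)
    funext x
    exact congrArg (fun f => f x) this
  simp [e]

theorem spanning (K : Type*) [Field K] (m : ℕ) {n q i0 : ℕ} (h : i0 + (q + 1) ≤ n) (N : ℕ) :
    ∀ w : Fin m × Fin n →₀ ℕ, wt w = N → MvPolynomial.monomial w (1 : K) ∈
      (PP K m h).restrictScalars K ⊔ MvPolynomial.restrictSupport K (Std h) := by
  induction N using Nat.strong_induction_on with
  | _ N ih =>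
  intro w hw
  by_cases hs : w ∈ Std h
  · apply Submodule.mem_sup_right
    rw [MvPolynomial.mem_restrictSupport_iff]
    intro x hx
    have := MvPolynomial.support_monomial_subset hx
    simp at this
    rwa [this]
  · simp only [Std, Set.mem_ofPred_eq, not_not] at hs
    obtain ⟨r, hr, hw0⟩ := hs
    set d : Equiv.Perm (Fin (q + 1)) → (Fin m × Fin n →₀ ℕ) := fun σ =>
      ∑ b, Finsupp.single (r (σ b), colf h b) 1 with hd
    have hle : d 1 ≤ w := by
      intro p
      simp only [hd, Equiv.Perm.one_apply, Finsupp.finsetSum_apply]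
      by_cases hp : ∃ b, (r b, colf h b) = p
      · obtain ⟨b, rfl⟩ := hp
        rw [Finset.sum_eq_single b]
        · simpa [Nat.one_le_iff_ne_zero] using hw0 b
        · intro c _ hc
          apply Finsupp.single_eq_of_ne
          intro e
          exact hc (colf_inj h (Prod.ext_iff.1 e).2.symm)
        · simp
      · rw [Finset.sum_eq_zero]
        · exact Nat.zero_le _
        · intro b _
          apply Finsupp.single_eq_of_ne
          intro e
          exact hp ⟨b, e.symm⟩
    obtain ⟨w', rfl⟩ := exists_add_of_le hle
    have hdet : Matrix.det (Matrix.of fun i j => (MvPolynomial.X (r i, colf h j) :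
        MvPolynomial (Fin m × Fin n) K)) =
        ∑ σ, ((Equiv.Perm.sign σ : ℤ) : MvPolynomial (Fin m × Fin n) K) *
          MvPolynomial.monomial (d σ) 1 := by
      rw [Matrix.det_apply']
      apply Finset.sum_congr rfl
      intro σ _
      rw [← prod_X_eq]
      rfl
    rw [← Finset.add_sum_erase _ _ (Finset.mem_univ 1)] at hdet
    have e1 : MvPolynomial.monomial (d 1 + w') (1 : K) =
        MvPolynomial.monomial w' 1 * Matrix.det (Matrix.of fun i j => (MvPolynomial.X (r i, colf h j) :
          MvPolynomial (Fin m × Fin n) K)) -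
        ∑ σ ∈ Finset.univ.erase 1, ((Equiv.Perm.sign σ : ℤ)) •
          MvPolynomial.monomial (d σ + w') (1 : K) := by
      have e2 : ∀ s : Fin m × Fin n →₀ ℕ, MvPolynomial.monomial (s + w') (1 : K) =
          MvPolynomial.monomial w' 1 * MvPolynomial.monomial s 1 := by
        intro s; rw [MvPolynomial.monomial_mul, add_comm, one_mul]
      rw [hdet]
      simp only [e2, zsmul_eq_mul, mul_add, Finset.mul_sum]
      rw [← Finset.sum_congr rfl (fun σ _ => mul_left_comm _ _ _)]
      simp
    rw [e1]
    apply Submodule.sub_mem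
    · apply Submodule.mem_sup_left
      apply Ideal.mul_mem_left
      exact Ideal.subset_span ⟨r, hr, rfl⟩
    · apply Submodule.sum_mem
      intro σ hσ
      apply zsmul_mem
      refine ih (wt (d σ + w')) ?_ _ rfl
      rw [← hw, map_add, map_add]
      have := wt_perm_lt h r hr σ (Finset.ne_of_mem_erase hσ)
      exact Nat.add_lt_add_right this _

theorem spanning_all (K : Type*) [Field K] (m : ℕ) {n q i0 : ℕ} (h : i0 + (q + 1) ≤ n)
    (F : MvPolynomial (Fin m × Fin n) K) :
    F ∈ (PP K m h).restrictScalars K ⊔ MvPolynomial.restrictSupport K (Std h) := by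
  induction F using MvPolynomial.induction_on' with
  | monomial w a =>
    have : MvPolynomial.monomial w a = a • MvPolynomial.monomial w (1 : K) := by
      rw [MvPolynomial.smul_monomial]; simp
    rw [this]
    exact Submodule.smul_mem _ _ (spanning K m h _ w rfl)
  | add p q hp hq => exact Submodule.add_mem _ hp hq

end KnutsonAux

namespace KnutsonAux

open Classical in
/-- Next element of the greedy chain. -/
noncomputable def nxt (W : ℕ → ℕ → Prop) (m lo k : ℕ) : ℕ :=
  if hx : ∃ r, lo ≤ r ∧ r < m ∧ W r k then Nat.find hx else max lo m

theorem nxt_ge (W : ℕ → ℕ → Prop) (m lo k : ℕ) : lo ≤ nxt W m lo k := by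
  classical
  unfold nxt
  split_ifs with hx
  · exact (Nat.find_spec hx).1
  · exact le_max_left _ _

theorem nxt_mem (W : ℕ → ℕ → Prop) (m lo k : ℕ) (hl : nxt W m lo k < m) :
    W (nxt W m lo k) k := by
  classical
  unfold nxt at *
  split_ifs at * with hx
  · exact (Nat.find_spec hx).2.2
  · omega

theorem nxt_min (W : ℕ → ℕ → Prop) (m lo k r : ℕ) (h1 : lo ≤ r) (h2 : r < m)
    (h3 : r < nxt W m lo k) : ¬ W r k := by
  classical
  intro hw
  unfold nxt at *
  have hx : ∃ r, lo ≤ r ∧ r < m ∧ W r k := ⟨r, h1, h2, hw⟩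
  rw [dif_pos hx] at h3
  exact Nat.find_min hx h3 ⟨h1, h2, hw⟩

/-- The greedy chain. -/
noncomputable def chain (W : ℕ → ℕ → Prop) (m : ℕ) : ℕ → ℕ
  | 0 => nxt W m 0 0
  | k + 1 => nxt W m (chain W m k + 1) (k + 1)

theorem exists_chain (W : ℕ → ℕ → Prop) (m : ℕ) :
    ∃ R : ℕ → ℕ, StrictMono R ∧ (∀ k, R k < m → W (R k) k) ∧
      (∀ k r, r < m → (∀ k' < k, R k' < r) → r < R k → ¬ W r k) := by
  refine ⟨chain W m, strictMono_nat_of_lt_succ fun k => ?_, ?_, ?_⟩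
  · exact nxt_ge W m (chain W m k + 1) (k + 1)
  · intro k hk
    cases k with
    | zero => exact nxt_mem _ _ _ _ hk
    | succ k => exact nxt_mem _ _ _ _ hk
  · intro k r hr hk hrk
    cases k with
    | zero => exact nxt_min W m 0 0 r (Nat.zero_le _) hr hrk
    | succ k => exact nxt_min W m _ _ r (hk k (by omega)) hr hrk

/-- The convex function used for exponents. -/
theorem convex_exp (R : ℕ → ℕ) (hR : StrictMono R) (r t c : ℕ) (hc1 : r ≤ R c)
    (hc2 : ∀ k < c, R k < r) (hct : c < t) (j : ℕ) (hj : j < t) (hjc : j ≠ c) :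
    r * (t - c) + (∑ k ∈ Finset.range c, R k) ≤ r * (t - j) + (∑ k ∈ Finset.range j, R k) ∧
    (r * (t - c) + (∑ k ∈ Finset.range c, R k) = r * (t - j) + (∑ k ∈ Finset.range j, R k) →
      j = c + 1 ∧ r = R c) := by
  have step : ∀ k, k < t → r * (t - k) = r * (t - (k + 1)) + r := by
    intro k hk
    have : t - k = (t - (k + 1)) + 1 := by omega
    rw [this, Nat.mul_add, mul_one]
  rcases Nat.lt_or_gt_of_ne hjc with hlt | hgt
  · -- j < c
    have : ∀ e, j + e < c → r * (t - (j + e + 1)) + (∑ k ∈ Finset.range (j + e + 1), R k) <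
        r * (t - j) + (∑ k ∈ Finset.range j, R k) := by
      intro e
      induction e with
      | zero =>
        intro he
        have := step j hj
        have := hc2 j hlt
        rw [add_zero, Finset.sum_range_succ]; omega
      | succ e ih =>
        intro he
        have h1 := ih (by omega)
        have h2 := step (j + e + 1) (by omega)
        have h3 := hc2 (j + e + 1) (by omega)
        rw [← add_assoc, Finset.sum_range_succ]
        omega
    have h4 := this (c - 1 - j) (by omega)
    have h5 : j + (c - 1 - j) + 1 = c := by omega
    rw [h5] at h4
    exact ⟨h4.le, fun h => absurd h h4.ne⟩
  · have h0 : r * (t - c) + (∑ k ∈ Finset.range c, R k) ≤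
        r * (t - (c + 1)) + (∑ k ∈ Finset.range (c + 1), R k) ∧
        (r * (t - c) + (∑ k ∈ Finset.range c, R k) =
        r * (t - (c + 1)) + (∑ k ∈ Finset.range (c + 1), R k) → r = R c) := by
      have := step c hct
      rw [Finset.sum_range_succ]
      omega
    have : ∀ e, c + 1 + e + 1 < t → r * (t - (c + 1)) + (∑ k ∈ Finset.range (c + 1), R k) <
        r * (t - (c + 1 + e + 1)) + (∑ k ∈ Finset.range (c + 1 + e + 1), R k) := by
      intro e
      induction e with
      | zero =>
        intro he
        have := step (c + 1) (by omega)
        have := hR (Nat.lt_succ_self c)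
        rw [add_zero, Finset.sum_range_succ _ (c + 1)]
        simp only [Nat.succ_eq_add_one] at *
        omega
      | succ e ih =>
        intro he
        have h1 := ih (by omega)
        have h2 := step (c + 1 + e + 1) (by omega)
        have h3 : R c < R (c + 1 + e + 1) := hR (by omega)
        rw [← add_assoc, Finset.sum_range_succ _ (c + 1 + e + 1)]
        omega
    by_cases hj1 : j = c + 1
    · subst hj1
      exact ⟨h0.1, fun h => ⟨rfl, h0.2 h⟩⟩
    · have h4 := this (j - c - 2) (by omega)
      have h5 : c + 1 + (j - c - 2) + 1 = j := by omega
      rw [h5] at h4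
      have h6 := h0.1.trans_lt h4
      exact ⟨h6.le, fun h => absurd h h6.ne⟩

/-- Abstract extraction of lowest terms. -/
theorem lowest_term (K : Type*) [Field K] {σ : Type*}
    (L : Type*) [Field L] [Algebra (MvPolynomial σ K) L]
    [IsFractionRing (MvPolynomial σ K) L] [Algebra K L] [IsScalarTower K (MvPolynomial σ K) L]
    (F : MvPolynomial σ K) (w0 : σ →₀ ℕ) (hw0 : w0 ∈ F.support)
    (om : σ → ℕ) (hmin : ∀ w ∈ F.support, (w0.sum fun p k => k * om p) ≤ w.sum fun p k => k * om p)
    (rho : σ → Polynomial L)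
    (hrho : ∀ p, (rho p).eval 0 = algebraMap (MvPolynomial σ K) L (MvPolynomial.X p) ∨
      (w0 p = 0 ∧ (rho p).eval 0 = 0))
    (h0 : MvPolynomial.aeval (fun p => Polynomial.X ^ om p * rho p) F = 0) : False := by
  classical
  set N := w0.sum fun p k => k * om p with hN
  let e : σ → K := fun p => if (rho p).eval 0 = algebraMap (MvPolynomial σ K) L (MvPolynomial.X p)
    then 1 else 0
  have he : ∀ p, (rho p).eval 0 = algebraMap (MvPolynomial σ K) L
      (MvPolynomial.C (e p) * MvPolynomial.X p) := by
    intro p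
    by_cases hp : (rho p).eval 0 = algebraMap (MvPolynomial σ K) L (MvPolynomial.X p)
    · simp only [e, if_pos hp]; simp [hp]
    · simp only [e, if_neg hp]
      rcases hrho p with h | h
      · exact absurd h hp
      · simp [h.2]
  have he1 : ∀ p, w0 p ≠ 0 → e p = 1 := by
    intro p hp
    rcases hrho p with h | h
    · simp only [e, if_pos h]
    · exact absurd h.1 hp
  have hco : ∀ w ∈ F.support, (∏ p ∈ w.support, (Polynomial.X ^ om p * rho p) ^ w p).coeff N =
      if (w.sum fun p k => k * om p) = N then algebraMap (MvPolynomial σ K) L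
        (MvPolynomial.monomial w (∏ p ∈ w.support, e p ^ w p)) else 0 := by
    intro w hw
    have h1 : (∏ p ∈ w.support, (Polynomial.X ^ om p * rho p) ^ w p) =
        (∏ p ∈ w.support, (rho p) ^ w p) * Polynomial.X ^ (w.sum fun p k => k * om p) := by
      simp only [mul_pow, Finset.prod_mul_distrib, ← pow_mul, Finset.prod_pow_eq_pow_sum]
      rw [mul_comm, Finsupp.sum]
      simp only [mul_comm]
    rw [h1, Polynomial.coeff_mul_X_pow']
    have h2 := hmin w hw
    split_ifs with h3 h4 h4
    · rw [h4, Nat.sub_self, Polynomial.coeff_zero_eq_eval_zero, Polynomial.eval_prod]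
      simp only [Polynomial.eval_pow, he]
      rw [MvPolynomial.monomial_eq, Finsupp.prod, map_prod, map_mul, map_prod, map_prod,
        ← Finset.prod_mul_distrib]
      apply Finset.prod_congr rfl
      intro p _
      rw [← map_mul, ← map_pow, mul_pow, map_pow]
    · omega
    · omega
    · rfl
  have h1 := congrArg (fun P : Polynomial L => P.coeff N) h0
  simp only [MvPolynomial.aeval_def, MvPolynomial.eval₂_eq, Polynomial.finsetSum_coeff,
    Polynomial.coeff_zero] at h1
  have h2 : ∀ w ∈ F.support, ((algebraMap K (Polynomial L)) (MvPolynomial.coeff w F) *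
      ∏ p ∈ w.support, (Polynomial.X ^ om p * rho p) ^ w p).coeff N =
      algebraMap (MvPolynomial σ K) L (if (w.sum fun p k => k * om p) = N then
        (MvPolynomial.monomial w (MvPolynomial.coeff w F * ∏ p ∈ w.support, e p ^ w p)) else 0) := by
    intro w hw
    rw [IsScalarTower.algebraMap_apply K L (Polynomial L), Polynomial.algebraMap_eq,
      Polynomial.coeff_C_mul, hco w hw]
    split_ifs
    · rw [IsScalarTower.algebraMap_apply K (MvPolynomial σ K) L, ← map_mul,
        MvPolynomial.algebraMap_eq, MvPolynomial.C_mul_monomial]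
    · simp
  rw [Finset.sum_congr rfl h2, ← map_sum] at h1
  have h3 := (map_eq_zero_iff _ (IsFractionRing.injective (MvPolynomial σ K) L)).1 h1
  have h4 := congrArg (MvPolynomial.coeff w0) h3
  rw [MvPolynomial.coeff_sum, Finset.sum_eq_single w0] at h4
  · rw [if_pos rfl, MvPolynomial.coeff_monomial, if_pos rfl, MvPolynomial.coeff_zero] at h4
    rw [Finset.prod_eq_one, mul_one] at h4
    · exact MvPolynomial.mem_support_iff.1 hw0 h4
    · intro p hp
      rw [he1 p (Finsupp.mem_support_iff.1 hp), one_pow]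
  · intro w _ hw
    split_ifs
    · rw [MvPolynomial.coeff_monomial, if_neg hw]
    · simp
  · intro h; exact absurd hw0 h

end KnutsonAux

namespace KnutsonAux

open Polynomial in
theorem kernel_sum {L : Type*} [Field L] (t c r : ℕ) (hc : c < t) (U xx : ℕ → L) (M : ℕ → ℕ)
    (hU : U c ≠ 0)
    (hle : ∀ j < t, j ≠ c → r * (t - c) + M c ≤ r * (t - j) + M j) :
    ∑ j ∈ Finset.range t, ((X : L[X]) ^ (r * (t - j)) * (if j = c then
      - ∑ j ∈ (Finset.range t).erase c, C (xx j * (U j / U c)) *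
          X ^ ((r * (t - j) + M j) - (r * (t - c) + M c)) else C (xx j))) *
      (C (U j) * X ^ (M j)) = 0 := by
  rw [← Finset.add_sum_erase _ _ (Finset.mem_range.2 hc)]
  simp only [if_true]
  rw [mul_neg, neg_mul, Finset.mul_sum, Finset.sum_mul, ← Finset.sum_neg_distrib,
    ← Finset.sum_add_distrib]
  apply Finset.sum_eq_zero
  intro j hj
  rw [if_neg (Finset.ne_of_mem_erase hj)]
  have h1 := hle j (Finset.mem_range.1 (Finset.mem_of_mem_erase hj)) (Finset.ne_of_mem_erase hj)
  have e1 : (C (xx j * (U j / U c)) : L[X]) * C (U c) = C (xx j) * C (U j) := by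
    rw [← C_mul, ← C_mul, mul_assoc, div_mul_cancel₀ _ hU]
  have e2 : (X : L[X]) ^ (r * (t - c)) * X ^ ((r * (t - j) + M j) - (r * (t - c) + M c)) * X ^ (M c) =
      X ^ (r * (t - j)) * X ^ (M j) := by
    rw [← pow_add, ← pow_add, ← pow_add]
    congr 1
    omega
  linear_combination (-(X ^ (r * (t - c)) * X ^ ((r * (t - j) + M j) - (r * (t - c) + M c)) * X ^ (M c)))
    * e1 - C (xx j) * C (U j) * e2

open Polynomial in
theorem rho_eval {L : Type*} [Field L] (t c : ℕ) (U xx : ℕ → L) (A : ℕ → ℕ) :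
    (- ∑ j ∈ (Finset.range t).erase c, C (xx j * (U j / U c)) *
          (X : L[X]) ^ (A j - A c)).eval 0 =
    - ∑ j ∈ (Finset.range t).erase c, (if A j ≤ A c then xx j * (U j / U c) else 0) := by
  rw [eval_neg, eval_finsetSum]
  congr 1
  apply Finset.sum_congr rfl
  intro j _
  rw [eval_mul, eval_C, eval_pow, eval_X]
  split_ifs with h
  · rw [Nat.sub_eq_zero_of_le h, pow_zero, mul_one]
  · rw [zero_pow (by omega), mul_zero]

theorem independent (K : Type*) [Field K] (m : ℕ) {n q i0 : ℕ} (h : i0 + (q + 1) ≤ n)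
    (F : MvPolynomial (Fin m × Fin n) K) (hF : F ∈ QQ K m h) (hs : (↑F.support : Set (Fin m × Fin n →₀ ℕ)) ⊆ Std h) :
    F = 0 := by
  classical
  by_contra hF0
  let L := FractionRing (MvPolynomial (Fin m × Fin n) K)
  let am : MvPolynomial (Fin m × Fin n) K →+* L := algebraMap _ _
  have am_inj : Function.Injective am := IsFractionRing.injective _ _
  let om : Fin m × Fin n → ℕ := fun p =>
    if i0 ≤ p.2.val ∧ p.2.val < i0 + (q + 1) then p.1.val * (q + 1 - (p.2.val - i0)) else 0
  obtain ⟨w0, hw0, hmin⟩ := Finset.exists_min_image F.support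
    (fun w : Fin m × Fin n →₀ ℕ => w.sum fun p k => k * om p)
    (MvPolynomial.support_nonempty.2 hF0)
  let W : ℕ → ℕ → Prop := fun r k => ∃ (hr : r < m) (hk : k < q + 1), w0 (⟨r, hr⟩, colf h ⟨k, hk⟩) ≠ 0
  obtain ⟨R, hR, hR1, hR2⟩ := exists_chain W m
  have hRq : m ≤ R q := by
    by_contra hlt
    push Not at hlt
    have hall : ∀ b : Fin (q + 1), R b < m := fun b =>
      lt_of_le_of_lt (hR.monotone (by omega)) hlt
    apply hs hw0
    refine ⟨fun b => ⟨R b, hall b⟩, ?_, ?_⟩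
    · intro a b hab
      rw [Fin.lt_def]
      exact hR hab
    · intro b
      obtain ⟨_, _, h3⟩ := hR1 b (hall b)
      exact h3
  have hcex : ∀ r, ∃ k, r ≤ R k := fun r => ⟨r, hR.le_apply⟩
  let c : ℕ → ℕ := fun r => Nat.find (hcex r)
  have hc1 : ∀ r, r ≤ R (c r) := fun r => Nat.find_spec (hcex r)
  have hc2 : ∀ r, ∀ k < c r, R k < r := fun r k hk => not_le.1 (Nat.find_min (hcex r) hk)
  have hc3 : ∀ r < m, c r < q + 1 := fun r hr =>
    Nat.lt_succ_of_le (Nat.find_min' (hcex r) (by omega))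
  let xx : ℕ → ℕ → L := fun r k =>
    if hh : r < m ∧ k < q + 1 then am (MvPolynomial.X (⟨r, hh.1⟩, colf h ⟨k, hh.2⟩)) else 1
  have hxx : ∀ r k, xx r k ≠ 0 := by
    intro r k
    simp only [xx]
    split_ifs
    · rw [Ne, map_eq_zero_iff _ am_inj]
      exact MvPolynomial.X_ne_zero _
    · exact one_ne_zero
  let V : ℕ → L := fun k => if R k < m then - xx (R k) k / xx (R k) (k + 1) else 1
  have hV : ∀ k, V k ≠ 0 := by
    intro k
    simp only [V]
    split_ifs
    · exact div_ne_zero (neg_ne_zero.2 (hxx _ _)) (hxx _ _)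
    · exact one_ne_zero
  let U : ℕ → L := fun j => ∏ k ∈ Finset.range j, V k
  have hU : ∀ j, U j ≠ 0 := fun j => Finset.prod_ne_zero_iff.2 fun k _ => hV k
  let M : ℕ → ℕ := fun j => ∑ k ∈ Finset.range j, R k
  let A : ℕ → ℕ → ℕ := fun r j => r * (q + 1 - j) + M j
  let S : ℕ → Polynomial L := fun r =>
    - ∑ j ∈ (Finset.range (q + 1)).erase (c r), Polynomial.C (xx r j * (U j / U (c r))) *
          Polynomial.X ^ (A r j - A r (c r))
  let rho : Fin m × Fin n → Polynomial L := fun p =>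
    if p.2.val = i0 + c p.1.val then S p.1.val else Polynomial.C (am (MvPolynomial.X p))
  refine lowest_term K L F w0 hw0 om hmin rho ?_ ?_
  · rintro ⟨r, cc⟩
    by_cases hcc : cc.val = i0 + c r.val
    · have hcr := hc3 r r.isLt
      have hcc' : cc = colf h ⟨c r, hcr⟩ := by ext; simp [colf, hcc]
      have hconv := fun j hj hjc => convex_exp R hR r (q + 1) (c r) (hc1 r) (hc2 r) hcr j hj hjc
      have hrho : (rho (r, cc)).eval 0 =
          - ∑ j ∈ (Finset.range (q + 1)).erase (c r),
            (if A r j ≤ A r (c r) then xx r j * (U j / U (c r)) else 0) := by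
        simp only [rho, if_pos hcc]
        exact rho_eval (q + 1) (c r) U (xx r) (A r)
      rw [hrho]
      by_cases hr : r.val = R (c r)
      · left
        have hc4 : c r < q := by
          by_contra hge
          have : R q ≤ R (c r) := hR.monotone (by omega)
          have := r.isLt
          omega
        rw [Finset.sum_eq_single (c r + 1)]
        · have hA : A r (c r + 1) ≤ A r (c r) := by
            simp only [A, M, Finset.sum_range_succ]
            have : q + 1 - c r = (q + 1 - (c r + 1)) + 1 := by omega
            rw [this, Nat.mul_add]
            omega
          rw [if_pos hA]
          have hUU : U (c r + 1) / U (c r) = - xx r (c r) / xx r (c r + 1) := by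
            have : U (c r + 1) = U (c r) * V (c r) := Finset.prod_range_succ _ _
            rw [this, mul_div_cancel_left₀ _ (hU _)]
            simp only [V]
            rw [← hr, if_pos r.isLt]
          rw [hUU, mul_div_cancel₀ _ (hxx _ _), neg_neg]
          simp only [xx, hcc']
          rw [dif_pos ⟨r.isLt, hcr⟩]
        · intro j hj hj1
          rw [if_neg]
          have h1 := hconv j (Finset.mem_range.1 (Finset.mem_of_mem_erase hj)) (Finset.ne_of_mem_erase hj)
          intro hle
          exact hj1 (h1.2 (le_antisymm h1.1 hle)).1
        · intro hn
          exfalso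
          apply hn
          simp
          omega
      · right
        constructor
        · by_contra hw
          refine hR2 (c r) r r.isLt (hc2 r) (lt_of_le_of_ne (hc1 r) hr) ⟨r.isLt, hcr, ?_⟩
          rw [← hcc']
          exact hw
        · rw [neg_eq_zero]
          apply Finset.sum_eq_zero
          intro j hj
          rw [if_neg]
          have h1 := hconv j (Finset.mem_range.1 (Finset.mem_of_mem_erase hj)) (Finset.ne_of_mem_erase hj)
          intro hle
          exact hr (h1.2 (le_antisymm h1.1 hle)).2
    · left
      simp only [rho, if_neg hcc, Polynomial.eval_C]
      rfl
  · refine QQ_spec K m h _ (fun b => Polynomial.C (U b) * Polynomial.X ^ (M b)) ?_ ?_ F hF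
    · simp [U, M]
    · intro r
      have hcr := hc3 r r.isLt
      have key := kernel_sum (q + 1) (c r) r hcr U (xx r) M (hU _)
        (fun j hj hjc => (convex_exp R hR r (q + 1) (c r) (hc1 r) (hc2 r) hcr j hj hjc).1)
      rw [← Fin.sum_univ_eq_sum_range (fun j => ((Polynomial.X : Polynomial L) ^ (r.val * (q + 1 - j)) *
        (if j = c r then
      - ∑ j ∈ (Finset.range (q + 1)).erase (c r), Polynomial.C (xx r j * (U j / U (c r))) *
          Polynomial.X ^ ((r.val * (q + 1 - j) + M j) - (r.val * (q + 1 - c r) + M (c r)))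
          else Polynomial.C (xx r j))) *
      (Polynomial.C (U j) * Polynomial.X ^ (M j))) (q + 1)] at key
      rw [← key]
      apply Finset.sum_congr rfl
      intro b _
      congr 2
      · simp only [om, colf]
        rw [if_pos (by have := b.isLt; omega)]
        simp
      · simp only [rho, S, A]
        have : ((colf h b).val = i0 + c r.val) ↔ (b.val = c r.val) := by simp [colf]
        simp only [this]
        split_ifs with hb
        · rfl
        · simp only [xx]
          rw [dif_pos ⟨r.isLt, b.isLt⟩]

theorem QQ_eq_PP (K : Type*) [Field K] (m : ℕ) {n q i0 : ℕ} (h : i0 + (q + 1) ≤ n) :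
    QQ K m h = PP K m h := by
  apply le_antisymm _ (PP_le_QQ K m h)
  intro F hF
  obtain ⟨y, hy, z, hz, rfl⟩ := Submodule.mem_sup.1 (spanning_all K m h F)
  have hy' : y ∈ PP K m h := hy
  have hz' : z ∈ QQ K m h := by
    have := Ideal.sub_mem _ hF (PP_le_QQ K m h hy')
    simpa using this
  have := independent K m h z hz' ((MvPolynomial.mem_restrictSupport_iff K).1 hz)
  rw [this, add_zero]
  exact hy'

end KnutsonAux

namespace KnutsonAux

theorem det_mul_small {E : Type*} [CommRing E] {q : ℕ} (A : Matrix (Fin (q + 1)) (Fin q) E)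
    (D : Matrix (Fin q) (Fin (q + 1)) E) : (A * D).det = 0 := by
  let A' : Matrix (Fin (q + 1)) (Fin (q + 1)) E := Matrix.of fun a b => (Fin.cons 0 (A a) : Fin (q + 1) → E) b
  let D' : Matrix (Fin (q + 1)) (Fin (q + 1)) E := Matrix.of fun a b =>
    (Fin.cons 0 (fun k => D k b) : Fin (q + 1) → E) a
  have : A * D = A' * D' := by
    ext a b
    rw [Matrix.mul_apply, Matrix.mul_apply, Fin.sum_univ_succ]
    simp [A', D']
  rw [this, Matrix.det_mul, Matrix.det_eq_zero_of_row_eq_zero (A := D') 0, mul_zero]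
  intro j
  simp [D']

theorem det_zero_rows {E : Type*} [CommRing E] {d q m : ℕ} (hm : m = d + 1 + q)
    (B : Matrix (Fin m) (Fin m) E) (Z : Matrix (Fin m) (Fin (q + 1)) E)
    (hB : ∀ a : Fin m, a.val ≤ d → ∀ j, (B * Z) a j = 0) (r : Fin (q + 1) → Fin m) :
    B.det ^ (q + 1) * (Z.submatrix r id).det = 0 := by
  subst hm
  have h1 : B.det • Z = B.adjugate * (B * Z) := by
    rw [← Matrix.mul_assoc, Matrix.adjugate_mul, Matrix.smul_mul, Matrix.one_mul]
  have h2 : B.det • (Z.submatrix r id) =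
      (Matrix.of fun (a : Fin (q + 1)) (k : Fin q) => B.adjugate (r a) (Fin.natAdd (d + 1) k)) *
      (Matrix.of fun (k : Fin q) (j : Fin (q + 1)) => (B * Z) (Fin.natAdd (d + 1) k) j) := by
    ext a j
    have := congrFun (congrFun h1 (r a)) j
    rw [Matrix.mul_apply, Fin.sum_univ_add, Finset.sum_eq_zero, zero_add] at this
    · rw [Matrix.mul_apply]
      exact this
    · intro x _
      rw [hB _ (by simp; omega), mul_zero]
  have h3 := congrArg Matrix.det h2
  rw [det_mul_small, Matrix.det_smul, Fintype.card_fin] at h3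
  exact h3

theorem det_mem_of_rows {E : Type*} [CommRing E] {d q m : ℕ} (hm : m = d + 1 + q) (J : Ideal E)
    (B : Matrix (Fin m) (Fin m) E) (Z : Matrix (Fin m) (Fin (q + 1)) E)
    (hB : ∀ a : Fin m, a.val ≤ d → ∀ j, (B * Z) a j ∈ J) (r : Fin (q + 1) → Fin m) :
    B.det ^ (q + 1) * (Z.submatrix r id).det ∈ J := by
  rw [← Ideal.Quotient.eq_zero_iff_mem, map_mul, map_pow, RingHom.map_det, RingHom.map_det]
  refine det_zero_rows hm ((Ideal.Quotient.mk J).mapMatrix B) (Z.map (Ideal.Quotient.mk J)) ?_ r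
  intro a ha j
  have := Ideal.Quotient.eq_zero_iff_mem.2 (hB a ha j)
  rw [← this, RingHom.mapMatrix_apply, ← Matrix.map_mul, Matrix.map_apply]

/-- The matrix extended by unit columns on both sides. -/
def ext {E : Type*} [CommRing E] {m n : ℕ} (A : Fin m × Fin n → E) (r : Fin m) (c : ℕ) : E :=
  if c + 1 < m then (if r.val + c + 2 = m then 1 else 0)
  else if hc : c + 1 - m < n then A (r, ⟨c + 1 - m, hc⟩)
  else (if r.val + c + 2 = 2 * m + n then 1 else 0)

theorem ext_map {E E' : Type*} [CommRing E] [CommRing E'] {m n : ℕ} (φ : E →+* E')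
    (A : Fin m × Fin n → E) (r : Fin m) (c : ℕ) : φ (ext A r c) = ext (fun p => φ (A p)) r c := by
  unfold ext
  split_ifs <;> simp

/-- Windows of `m` adjacent columns of the extended matrix. -/
def win {E : Type*} [CommRing E] {m n : ℕ} (A : Fin m × Fin n → E) (c0 : ℕ) : Matrix (Fin m) (Fin m) E :=
  Matrix.of fun r b => ext A r (c0 + b.val)

theorem win_map {E E' : Type*} [CommRing E] [CommRing E'] {m n : ℕ} (φ : E →+* E')
    (A : Fin m × Fin n → E) (c0 : ℕ) : φ.mapMatrix (win A c0) = win (fun p => φ (A p)) c0 := by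
  ext r b
  simp [win, ext_map]

theorem ext_col {E : Type*} [CommRing E] {m n q i0 d : ℕ} (hm : m = d + 1 + q)
    (h : i0 + (q + 1) ≤ n) (A : Fin m × Fin n → E) (r : Fin m) (j : Fin (q + 1)) (c : ℕ)
    (hc : c = d + q + i0 + j.val) : ext A r c = A (r, colf h j) := by
  unfold ext
  have := j.isLt
  rw [if_neg (by omega), dif_pos (show c + 1 - m < n by omega)]
  congr 2
  simp only [colf, Fin.mk.injEq]
  omega

/-- The transition matrix. -/
def Bhat {E : Type*} [CommRing E] {m n : ℕ} (d q i0 : ℕ) (hdm : d < m) (l : Fin m → Fin m)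
    (A : Fin m × Fin n → E) : Matrix (Fin m) (Fin m) E :=
  Matrix.of fun a r => if a.val ≤ d then
    ((win A (i0 + q + a.val)).updateCol ⟨d - a.val, by omega⟩ (Pi.single r 1)).det
    else if l a = r then 1 else 0

theorem Bhat_map {E E' : Type*} [CommRing E] [CommRing E'] {m n : ℕ} (φ : E →+* E')
    (d q i0 : ℕ) (hdm : d < m) (l : Fin m → Fin m)
    (A : Fin m × Fin n → E) :
    φ.mapMatrix (Bhat d q i0 hdm l A) = Bhat d q i0 hdm l (fun p => φ (A p)) := by
  ext a r
  simp only [Bhat, RingHom.mapMatrix_apply, Matrix.map_apply, Matrix.of_apply]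
  split_ifs
  · rw [RingHom.map_det, ← win_map]
    congr 1
    ext x y
    simp only [RingHom.mapMatrix_apply, Matrix.map_apply, Matrix.updateCol_apply, Pi.single_apply]
    split_ifs <;> simp
  · simp
  · simp

theorem Bhat_mulVec {E : Type*} [CommRing E] {m n : ℕ} (d q i0 : ℕ) (hdm : d < m) (l : Fin m → Fin m)
    (A : Fin m × Fin n → E) (z : Fin m → E) (a : Fin m) :
    (Bhat d q i0 hdm l A).mulVec z a = if a.val ≤ d then
    ((win A (i0 + q + a.val)).updateCol ⟨d - a.val, by omega⟩ z).det else z (l a) := by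
  simp only [Matrix.mulVec, dotProduct, Bhat, Matrix.of_apply]
  split_ifs with h
  · simp only [← Matrix.cramer_apply]
    rw [LinearMap.pi_apply_eq_sum_univ (Matrix.cramer (win A (i0 + q + a.val))) z, Finset.sum_apply]
    apply Finset.sum_congr rfl
    intro r _
    rw [Pi.smul_apply, smul_eq_mul, mul_comm]
    have e : (Pi.single r 1 : Fin m → E) = fun j => if r = j then 1 else 0 := by
      funext j
      simp [Pi.single_apply, eq_comm]
    rw [e]
  · simp

theorem Bhat_mul_mem {E : Type*} [CommRing E] {m n q i0 d : ℕ} (hm : m = d + 1 + q)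
    (h : i0 + (q + 1) ≤ n) (l : Fin m → Fin m)
    (A : Fin m × Fin n → E) (J : Ideal E) (hJ : ∀ a ≤ d, (win A (i0 + q + a)).det ∈ J)
    (a : Fin m) (ha : a.val ≤ d) (j : Fin (q + 1)) :
    (Bhat d q i0 (by omega) l A * (Matrix.of fun r j => A (r, colf h j))) a j ∈ J := by
  have e : (Bhat d q i0 (by omega) l A * (Matrix.of fun r j => A (r, colf h j))) a j =
      (Bhat d q i0 (by omega) l A).mulVec (fun r => A (r, colf h j)) a := rfl
  rw [e, Bhat_mulVec, if_pos ha]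
  by_cases hj : j.val = 0
  · have : (win A (i0 + q + a.val)).updateCol ⟨d - a.val, by omega⟩ (fun r => A (r, colf h j)) =
        win A (i0 + q + a.val) := by
      ext r b
      rw [Matrix.updateCol_apply]
      split_ifs with hb
      · subst hb
        simp only [win, Matrix.of_apply]
        rw [ext_col hm h A r j _ (by omega)]
      · rfl
    rw [this]
    exact hJ _ ha
  · have hj2 := j.isLt
    rw [Matrix.det_zero_of_column_eq (i := ⟨d - a.val, by omega⟩) (j := ⟨d - a.val + j.val, by omega⟩)]
    · exact J.zero_mem
    · simp only [Ne, Fin.mk.injEq]; omega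
    · intro r
      rw [Matrix.updateCol_self, Matrix.updateCol_ne (by simp only [Ne, Fin.mk.injEq]; omega)]
      simp only [win, Matrix.of_apply]
      rw [ext_col hm h A r j _ (by omega)]

theorem s_mul_PP (K : Type*) [Field K] {m n q i0 d : ℕ} (hm : m = d + 1 + q)
    (h : i0 + (q + 1) ≤ n) (l : Fin m → Fin m)
    (J : Ideal (MvPolynomial (Fin m × Fin n) K))
    (hJ : ∀ a ≤ d, (win (MvPolynomial.X : Fin m × Fin n → MvPolynomial (Fin m × Fin n) K)
      (i0 + q + a)).det ∈ J) (p : MvPolynomial (Fin m × Fin n) K) (hp : p ∈ PP K m h) :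
    p * (Bhat d q i0 (by omega) l (MvPolynomial.X : Fin m × Fin n →
      MvPolynomial (Fin m × Fin n) K)).det ^ (q + 1) ∈ J := by
  unfold PP at hp
  induction hp using Submodule.span_induction with
  | mem x hx =>
    obtain ⟨r, hr, rfl⟩ := hx
    rw [mul_comm]
    exact det_mem_of_rows hm J _ (Matrix.of fun r j => MvPolynomial.X (r, colf h j))
      (fun a ha j => Bhat_mul_mem hm h l _ J hJ a ha j) r
  | zero => rw [zero_mul]; exact J.zero_mem
  | add x y _ _ hx hy => rw [add_mul]; exact J.add_mem hx hy
  | smul a x _ hx => rw [smul_eq_mul, mul_assoc]; exact J.mul_mem_left _ hx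

theorem win_mem_QQ (K : Type*) [Field K] {m n q i0 d : ℕ} (hm : m = d + 1 + q)
    (h : i0 + (q + 1) ≤ n) (a : ℕ) (ha : a ≤ d) :
    (win (MvPolynomial.X : Fin m × Fin n → MvPolynomial (Fin m × Fin n) K)
      (i0 + q + a)).det ∈ QQ K m h := by
  rw [mem_QQ]
  have e := RingHom.map_det (MvPolynomial.aeval (R := K) (gen0 K m h)).toRingHom
    (win (MvPolynomial.X : Fin m × Fin n → MvPolynomial (Fin m × Fin n) K) (i0 + q + a))
  rw [win_map] at e
  refine e.trans ?_
  simp only [AlgHom.toRingHom_eq_coe, RingHom.coe_coe, MvPolynomial.aeval_X]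
  rw [← Matrix.exists_mulVec_eq_zero_iff]
  let v : Fin (q + 1) → MvPolynomial ((Fin m × Fin n) ⊕ Fin q) K :=
    Fin.cons (-1) (fun b => MvPolynomial.X (Sum.inr b))
  let f : Fin (q + 1) → Fin m := fun j => ⟨d - a + j.val, by omega⟩
  have hf : Function.Injective f := by
    intro x y hxy
    simp only [f, Fin.mk.injEq] at hxy
    ext; omega
  refine ⟨Function.extend f v 0, ?_, ?_⟩
  · intro h0
    have := congrFun h0 (f 0)
    rw [hf.extend_apply] at this
    simp [v] at this
  · funext r
    simp only [Matrix.mulVec, dotProduct]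
    have h1 : ∑ b, win (gen0 K m h) (i0 + q + a) r b * Function.extend f v 0 b =
        ∑ j, win (gen0 K m h) (i0 + q + a) r (f j) * v j := by
      rw [← Finset.sum_subset (Finset.subset_univ (Finset.univ.image f)),
        Finset.sum_image (fun x _ y _ hxy => hf hxy)]
      · simp only [hf.extend_apply]
      · intro x _ hx
        rw [Function.extend_apply', Pi.zero_apply, mul_zero]
        rintro ⟨y, rfl⟩
        exact hx (Finset.mem_image_of_mem f (Finset.mem_univ y))
    refine h1.trans ?_
    refine Eq.trans ?_ (gen0_ker K m h r)
    apply Finset.sum_congr rfl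
    intro j _
    congr 1
    simp only [win, Matrix.of_apply, f]
    exact ext_col hm h _ r j _ (by omega)

end KnutsonAux

namespace KnutsonAux

theorem exists_perm {m n q i0 d : ℕ} (hm : m = d + 1 + q) (h : i0 + (q + 1) ≤ n) (hmn : m < n) :
    ∃ l : Equiv.Perm (Fin m),
      (∀ e : Fin m, e.val + i0 < d → (l e).val + i0 + 1 + e.val = d) ∧
      (∀ e : Fin m, e.val + 2 ≤ d → n ≤ e.val + 1 + i0 + (q + 1) →
        (l e).val + e.val + 2 + i0 + (q + 1) = m + n) ∧
      (∀ e : Fin m, e.val = d → i0 + (q + 1) = n → (l e).val + 1 = m) := by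
  classical
  let f0 : ℕ → ℕ := fun e => if e + i0 < d then d - 1 - i0 - e else if e = d then m - 1
    else m + n - 2 - i0 - (q + 1) - e
  let f : Fin m → Fin m := fun e => if hh : f0 e < m then ⟨f0 e, hh⟩ else e
  let s : Finset (Fin m) := Finset.univ.filter fun e => e.val + i0 < d ∨
    (e.val + 2 ≤ d ∧ n ≤ e.val + 1 + i0 + (q + 1)) ∨ (e.val = d ∧ i0 + (q + 1) = n)
  have hf0 : ∀ e ∈ s, (f e).val = f0 e := by
    intro e he
    simp only [s, Finset.mem_filter, Finset.mem_univ, true_and] at he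
    have : f0 e < m := by
      simp only [f0]
      split_ifs <;> omega
    simp only [f, dif_pos this]
  obtain ⟨g, hg⟩ := Finset.exists_equiv_extend_of_card_eq (α := Fin m) (t := (Finset.univ : Finset (Fin m)))
    (by simp) (s := s) (f := f) (Finset.subset_univ _) (by
      intro x hx y hy hxy
      have h1 := hf0 x hx
      have h2 := hf0 y hy
      rw [hxy, h2] at h1
      simp only [s, Finset.coe_filter, Finset.mem_univ, true_and, Set.mem_ofPred_eq] at hx hy
      ext
      simp only [f0] at h1
      split_ifs at h1 <;> omega)
  refine ⟨g.trans (Equiv.subtypeUnivEquiv (by simp)), ?_, ?_, ?_⟩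
  · intro e he
    have hs : e ∈ s := by simp only [s, Finset.mem_filter, Finset.mem_univ, true_and]; omega
    have h1 := hf0 e hs
    rw [← hg e hs] at h1
    simp only [f0] at h1
    simp only [Equiv.trans_apply, Equiv.subtypeUnivEquiv_apply]
    split_ifs at h1 <;> omega
  · intro e he1 he2
    have hs : e ∈ s := by simp only [s, Finset.mem_filter, Finset.mem_univ, true_and]; omega
    have h1 := hf0 e hs
    rw [← hg e hs] at h1
    simp only [f0] at h1
    simp only [Equiv.trans_apply, Equiv.subtypeUnivEquiv_apply]
    split_ifs at h1 <;> omega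
  · intro e he1 he2
    have hs : e ∈ s := by simp only [s, Finset.mem_filter, Finset.mem_univ, true_and]; omega
    have h1 := hf0 e hs
    rw [← hg e hs] at h1
    simp only [f0] at h1
    simp only [Equiv.trans_apply, Equiv.subtypeUnivEquiv_apply]
    split_ifs at h1 <;> omega

/-- Label of a column. -/
def lam (m d e : ℕ) : ℕ := if e < m then e else if e = m then d else e - m - 1

/-- Label of a column as an element of `Fin m`. -/
def lamF (m d e : ℕ) (hm : 0 < m) : Fin m := if hh : lam m d e < m then ⟨lam m d e, hh⟩ else ⟨0, hm⟩

theorem lamF_val (m d e : ℕ) (hm : 0 < m) (hd : d < m) (he : e < d + m) :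
    (lamF m d e hm).val = lam m d e := by
  have : lam m d e < m := by
    unfold lam; split_ifs <;> omega
  simp only [lamF, dif_pos this]

/-- A point. -/
def pt (K : Type*) [Field K] {m n : ℕ} (d i0 : ℕ) (hm : 0 < m) (l : Fin m → Fin m) :
    Fin m × Fin n → K := fun p =>
  if p.2.val = i0 then 0 else if i0 ≤ p.2.val + d then
    (if p.1 = l (lamF m d (p.2.val + d - i0) hm) then 1 else 0) else 0

theorem ext_pt (K : Type*) [Field K] {m n q i0 d : ℕ} (hm : m = d + 1 + q) (h : i0 + (q + 1) ≤ n)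
    (hm0 : 0 < m) (l : Fin m → Fin m)
    (h1 : ∀ e : Fin m, e.val + i0 < d → (l e).val + i0 + 1 + e.val = d)
    (h2 : ∀ e : Fin m, e.val + 2 ≤ d → n ≤ e.val + 1 + i0 + (q + 1) →
        (l e).val + e.val + 2 + i0 + (q + 1) = m + n)
    (h3 : ∀ e : Fin m, e.val = d → i0 + (q + 1) = n → (l e).val + 1 = m)
    (e : ℕ) (he : e < d + m) (hed : e ≠ d) (r : Fin m) :
    ext (pt K (n := n) d i0 hm0 l) r (i0 + q + e) = if r = l (lamF m d e hm0) then 1 else 0 := by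
  have hv := lamF_val m d e hm0 (by omega) he
  unfold ext
  split_ifs with c1 c2 c3 c4 c5 c6 c7 c8
  all_goals first
    | rfl
    | skip
  · exfalso
    have := h1 (lamF m d e hm0) (by rw [hv]; unfold lam; split_ifs <;> omega)
    apply c3
    ext
    rw [hv] at this
    unfold lam at this
    split_ifs at this <;> omega
  · exfalso
    have := h1 (lamF m d e hm0) (by rw [hv]; unfold lam; split_ifs <;> omega)
    rw [hv] at this
    rw [Fin.ext_iff] at c4
    unfold lam at this
    split_ifs at this <;> omega
  · simp only [pt]
    have e1 : i0 + q + e + 1 - m + d - i0 = e := by omega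
    rw [if_neg (by omega), if_pos (by omega), e1, if_pos c6]
  · simp only [pt]
    have e1 : i0 + q + e + 1 - m + d - i0 = e := by omega
    rw [if_neg (by omega), if_pos (by omega), e1, if_neg c6]
  · exfalso
    by_cases hem : e = m
    · have := h3 (lamF m d e hm0) (by rw [hv]; unfold lam; split_ifs <;> omega) (by omega)
      rw [Fin.ext_iff] at *
      omega
    · have := h2 (lamF m d e hm0) (by rw [hv]; unfold lam; split_ifs <;> omega)
        (by rw [hv]; unfold lam; split_ifs <;> omega)
      rw [Fin.ext_iff] at *
      rw [hv] at this
      unfold lam at this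
      split_ifs at this <;> omega
  · exfalso
    by_cases hem : e = m
    · have := h3 (lamF m d e hm0) (by rw [hv]; unfold lam; split_ifs <;> omega) (by omega)
      rw [Fin.ext_iff] at *
      omega
    · have := h2 (lamF m d e hm0) (by rw [hv]; unfold lam; split_ifs <;> omega)
        (by rw [hv]; unfold lam; split_ifs <;> omega)
      rw [Fin.ext_iff] at *
      rw [hv] at this
      unfold lam at this
      split_ifs at this <;> omega

theorem det_upd_pt (K : Type*) [Field K] {m n q i0 d : ℕ} (hm : m = d + 1 + q)
    (hm0 : 0 < m) (l : Equiv.Perm (Fin m))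
    (hext : ∀ e : ℕ, e < d + m → e ≠ d → ∀ r : Fin m,
      ext (pt K (n := n) d i0 hm0 l) r (i0 + q + e) = if r = l (lamF m d e hm0) then 1 else 0)
    (a : ℕ) (ha : a ≤ d) (z : Fin m → K)
    (hz : ((win (pt K (n := n) d i0 hm0 l) (i0 + q + a)).updateCol ⟨d - a, by omega⟩ z).det = 0)
    (o : Fin m) (ho : o.val = if a = 0 then d else a - 1) :
    z (l o) = 0 := by
  classical
  let x : Fin m := ⟨d - a, by omega⟩
  let p0 : Fin m → Fin m := fun b => if b = x then o else lamF m d (a + b.val) hm0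
  have hp0 : Function.Injective p0 := by
    intro b b' hbb
    have e1 : ∀ b : Fin m, (p0 b).val = if b.val = d - a then (if a = 0 then d else a - 1) else
        lam m d (a + b.val) := by
      intro b
      simp only [p0, x, Fin.ext_iff]
      split_ifs with c1 c2 c2
      · rw [ho, if_pos c2]
      · rw [ho, if_neg c2]
      · exact lamF_val m d _ hm0 (by omega) (by have := b.isLt; omega)
    have h1 := e1 b
    rw [hbb, e1 b'] at h1
    unfold lam at h1
    have := b.isLt
    have := b'.isLt
    ext
    split_ifs at h1 <;> omega
  let p : Equiv.Perm (Fin m) := (Equiv.ofBijective p0 (Finite.injective_iff_bijective.1 hp0)).trans l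
  have hp : ∀ b, p b = l (p0 b) := fun b => rfl
  have e2 : ((win (pt K (n := n) d i0 hm0 l) (i0 + q + a)).updateCol x z).submatrix p id =
      (1 : Matrix (Fin m) (Fin m) K).updateCol x (fun b => z (p b)) := by
    ext b' b
    rw [Matrix.submatrix_apply, Matrix.updateCol_apply, Matrix.updateCol_apply, id]
    split_ifs with hb
    · rfl
    · simp only [win, Matrix.of_apply]
      have hb2 : b.val ≠ d - a := fun hh => hb (Fin.ext hh)
      rw [add_assoc, hext (a + b.val) (by have := b.isLt; omega) (by omega), Matrix.one_apply]
      have : l (lamF m d (a + b.val) hm0) = p b := by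
        rw [hp]; simp only [p0, if_neg hb]
      rw [this]
      simp
  have e3 := congrArg Matrix.det e2
  rw [Matrix.det_permute, hz, mul_zero, ← Matrix.cramer_apply, Matrix.cramer_one] at e3
  have e4 : z (p x) = 0 := e3.symm
  rw [hp] at e4
  simpa only [p0, if_true] using e4

theorem exists_s (K : Type*) [Field K] {m n q i0 d : ℕ} (hm : m = d + 1 + q)
    (h : i0 + (q + 1) ≤ n) (hmn : m < n) :
    ∃ l : Fin m → Fin m, (Bhat d q i0 (by omega) l (MvPolynomial.X : Fin m × Fin n →
      MvPolynomial (Fin m × Fin n) K)).det ∉ QQ K m h := by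
  obtain ⟨l, h1, h2, h3⟩ := exists_perm hm h hmn
  have hm0 : 0 < m := by omega
  refine ⟨l, fun hmem => ?_⟩
  have h4 := QQ_spec K m h (pt K (n := n) d i0 hm0 l) (Pi.single 0 1) (by simp) (by
    intro r
    simp [Pi.single_apply, pt, colf]) _ hmem
  have e := RingHom.map_det (MvPolynomial.aeval (R := K) (pt K (n := n) d i0 hm0 l)).toRingHom
    (Bhat d q i0 (by omega) l (MvPolynomial.X : Fin m × Fin n → MvPolynomial (Fin m × Fin n) K))
  rw [Bhat_map] at e
  have h5 := e.symm.trans h4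
  simp only [AlgHom.toRingHom_eq_coe, RingHom.coe_coe, MvPolynomial.aeval_X] at h5
  rw [← Matrix.exists_mulVec_eq_zero_iff] at h5
  obtain ⟨z, hz0, hz⟩ := h5
  apply hz0
  have hext := ext_pt K hm h hm0 l h1 h2 h3
  have key : ∀ o, z (l o) = 0 := by
    intro o
    have hrow := fun a => (Bhat_mulVec d q i0 (by omega) l (pt K (n := n) d i0 hm0 l) z a).symm.trans
      (congrFun hz a)
    by_cases ho : o.val ≤ d
    · let a : Fin m := ⟨if o.val = d then 0 else o.val + 1, by split_ifs <;> omega⟩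
      have hav : a.val = if o.val = d then 0 else o.val + 1 := rfl
      have ha : a.val ≤ d := by rw [hav]; split_ifs <;> omega
      have := hrow a
      rw [if_pos ha] at this
      exact det_upd_pt K hm hm0 l hext a.val ha z this o (by
        by_cases hod : o.val = d
        · rw [if_pos hod] at hav
          rw [if_pos hav, hod]
        · rw [if_neg hod] at hav
          rw [if_neg (by omega)]
          omega)
    · have := hrow o
      rw [if_neg ho] at this
      exact this
  funext r
  have := key (l.symm r)
  rwa [Equiv.apply_symm_apply] at this

end KnutsonAux

namespace KnutsonAux

theorem rev_det_unit (E : Type*) [CommRing E] (p : ℕ) :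
    IsUnit (Matrix.of fun (a b : Fin p) => if a.val + b.val + 1 = p then (1 : E) else 0).det := by
  have e : (Matrix.of fun (a b : Fin p) => if a.val + b.val + 1 = p then (1 : E) else 0) =
      (1 : Matrix (Fin p) (Fin p) E).submatrix Fin.revPerm id := by
    ext a b
    rw [Matrix.submatrix_apply, Matrix.one_apply, Matrix.of_apply]
    refine if_congr ?_ rfl rfl
    rw [Fin.ext_iff, Fin.revPerm_apply, Fin.val_rev, id]
    omega
  rw [e, Matrix.det_permute, Matrix.det_one, mul_one]
  rcases Int.units_eq_one_or (Equiv.Perm.sign (Fin.revPerm : Equiv.Perm (Fin p))) with h | h <;> simp [h]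

theorem win_left {E : Type*} [CommRing E] {p k n m : ℕ} (hm : m = p + (k + 1)) (hn : m < n)
    (A : Fin m × Fin n → E) :
    Associated (win A k).det (Matrix.of fun (i j : Fin (k + 1)) =>
        A ((⟨m - 1 - k + i.val, by omega⟩ : Fin m), (⟨j.val, by omega⟩ : Fin n))).det := by
  subst hm
  let e : Fin p ⊕ Fin (k + 1) ≃ Fin (p + (k + 1)) := finSumFinEquiv
  have h1 : (win A k).submatrix e e = Matrix.fromBlocks
      (Matrix.of fun (a b : Fin p) => if a.val + b.val + 1 = p then (1 : E) else 0)
      (Matrix.of fun (a : Fin p) (b : Fin (k + 1)) => win A k (e (Sum.inl a)) (e (Sum.inr b)))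
      0
      (Matrix.of fun (i j : Fin (k + 1)) =>
        A ((⟨p + (k + 1) - 1 - k + i.val, by omega⟩ : Fin (p + (k + 1))), (⟨j.val, by omega⟩ : Fin n))) := by
    ext a b
    rcases a with a | a <;> rcases b with b | b
    · simp only [Matrix.submatrix_apply, Matrix.fromBlocks_apply₁₁, Matrix.of_apply, win, ext, e,
        finSumFinEquiv_apply_left, Fin.val_castAdd]
      rw [if_pos (by omega)]
      exact if_congr (by omega) rfl rfl
    · simp
    · simp only [Matrix.submatrix_apply, Matrix.fromBlocks_apply₂₁, Matrix.of_apply, win, ext, e,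
        finSumFinEquiv_apply_left, finSumFinEquiv_apply_right, Fin.val_castAdd, Fin.val_natAdd]
      rw [if_pos (by omega), if_neg (by omega)]
      rfl
    · simp only [Matrix.submatrix_apply, Matrix.fromBlocks_apply₂₂, Matrix.of_apply, win, ext, e,
        finSumFinEquiv_apply_right, Fin.val_natAdd]
      rw [if_neg (by omega), dif_pos (by omega)]
      congr 2
      · apply Fin.ext; simp <;> omega
      · apply Fin.ext; simp <;> omega
  rw [← Matrix.det_submatrix_equiv_self e (win A k), h1, Matrix.det_fromBlocks_zero₂₁]
  exact associated_unit_mul_left _ _ (rev_det_unit E p)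

theorem win_right {E : Type*} [CommRing E] {p k n m : ℕ} (hm : m = (k + 1) + p) (hn : m < n)
    (hp : 0 < p) (A : Fin m × Fin n → E) :
    Associated (win A (n + p - 1)).det (Matrix.of fun (i j : Fin (k + 1)) =>
        A ((⟨i.val, by omega⟩ : Fin m), (⟨n - 1 - k + j.val, by omega⟩ : Fin n))).det := by
  subst hm
  let e : Fin (k + 1) ⊕ Fin p ≃ Fin ((k + 1) + p) := finSumFinEquiv
  have h1 : (win A (n + p - 1)).submatrix e e = Matrix.fromBlocks
      (Matrix.of fun (i j : Fin (k + 1)) =>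
        A ((⟨i.val, by omega⟩ : Fin ((k + 1) + p)), (⟨n - 1 - k + j.val, by omega⟩ : Fin n)))
      0
      (Matrix.of fun (a : Fin p) (b : Fin (k + 1)) =>
        win A (n + p - 1) (e (Sum.inr a)) (e (Sum.inl b)))
      (Matrix.of fun (a b : Fin p) => if a.val + b.val + 1 = p then (1 : E) else 0) := by
    ext a b
    rcases a with a | a <;> rcases b with b | b
    · simp only [Matrix.submatrix_apply, Matrix.fromBlocks_apply₁₁, Matrix.of_apply, win, ext, e,
        finSumFinEquiv_apply_left, Fin.val_castAdd]
      rw [if_neg (by omega), dif_pos (by omega)]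
      congr 2
      apply Fin.ext; simp <;> omega
    · simp only [Matrix.submatrix_apply, Matrix.fromBlocks_apply₁₂, Matrix.of_apply, win, ext, e,
        finSumFinEquiv_apply_left, finSumFinEquiv_apply_right, Fin.val_castAdd, Fin.val_natAdd]
      rw [if_neg (by omega), dif_neg (by omega), if_neg (by omega)]
      rfl
    · simp
    · simp only [Matrix.submatrix_apply, Matrix.fromBlocks_apply₂₂, Matrix.of_apply, win, ext, e,
        finSumFinEquiv_apply_right, Fin.val_natAdd]
      rw [if_neg (by omega), dif_neg (by omega)]
      exact if_congr (by omega) rfl rfl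
  rw [← Matrix.det_submatrix_equiv_self e (win A _), h1, Matrix.det_fromBlocks_zero₁₂]
  exact associated_mul_unit_left _ _ (rev_det_unit E p)

theorem win_mid {E : Type*} [CommRing E] {k n m : ℕ} (hm : 0 < m) (hk : k + m ≤ n)
    (A : Fin m × Fin n → E) :
    win A (m - 1 + k) = (Matrix.of fun (i j : Fin m) =>
        A ((⟨i.val, i.isLt⟩ : Fin m), (⟨k + j.val, by omega⟩ : Fin n))) := by
  ext a b
  simp only [win, ext, Matrix.of_apply]
  rw [if_neg (by omega), dif_pos (by omega)]
  congr 2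
  apply Fin.ext; simp <;> omega

theorem det_minor_ne (K : Type*) [Field K] {m n k : ℕ} (r : Fin k → Fin m) (c : Fin k → Fin n)
    (hr : Function.Injective r) (hc : Function.Injective c) :
    (Matrix.of fun i j => (MvPolynomial.X (r i, c j) : MvPolynomial (Fin m × Fin n) K)).det ≠ 0 := by
  have h0 := Matrix.det_mvPolynomialX_ne_zero (Fin k) K
  have hinj : Function.Injective (fun p : Fin k × Fin k => (r p.1, c p.2)) := by
    rintro ⟨a, b⟩ ⟨a', b'⟩ hh
    simp only [Prod.mk.injEq] at hh
    rw [hr hh.1, hc hh.2]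
  have h1 := (MvPolynomial.rename_injective (R := K) _ hinj).ne h0
  rw [map_zero] at h1
  intro hz
  apply h1
  rw [← hz, AlgHom.map_det]
  congr 1
  ext i j
  simp [Matrix.mvPolynomialX]

theorem knutsonF_ne_zero (K : Type*) [Field K] (m n : ℕ) (hm : 0 < m) (hmn : m < n) :
    knutsonF K m n hm hmn ≠ 0 := by
  unfold knutsonF
  refine mul_ne_zero (Finset.prod_ne_zero_iff.2 fun k _ => mul_ne_zero ?_ ?_)
    (Finset.prod_ne_zero_iff.2 fun k _ => ?_)
  all_goals
    apply det_minor_ne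
    all_goals
      intro a b hab
      simp only [Fin.mk.injEq] at hab
      apply Fin.ext
      omega

/-- Lower left corner minors. -/
noncomputable def FL (K : Type*) [Field K] (m n : ℕ) (hmn : m < n) (k : Fin (m - 1)) :
    MvPolynomial (Fin m × Fin n) K :=
  Matrix.det (Matrix.of fun (i j : Fin (k.val + 1)) =>
        MvPolynomial.X ((⟨m - 1 - k.val + i.val, by omega⟩ : Fin m),
                        (⟨j.val, by omega⟩ : Fin n)))

/-- Upper right corner minors. -/
noncomputable def FR (K : Type*) [Field K] (m n : ℕ) (hmn : m < n) (k : Fin (m - 1)) :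
    MvPolynomial (Fin m × Fin n) K :=
  Matrix.det (Matrix.of fun (i j : Fin (k.val + 1)) =>
        MvPolynomial.X ((⟨i.val, by omega⟩ : Fin m),
                        (⟨n - 1 - k.val + j.val, by omega⟩ : Fin n)))

theorem win_dvd (K : Type*) [Field K] (m n : ℕ) (hm : 0 < m) (hmn : m < n) (c0 : ℕ)
    (hc : c0 ≤ n + m - 2) :
    (win (MvPolynomial.X : Fin m × Fin n → MvPolynomial (Fin m × Fin n) K) c0).det ∣
      knutsonF K m n hm hmn := by
  unfold knutsonF
  by_cases h1 : c0 + 1 < m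
  · obtain ⟨p, hp⟩ : ∃ p, m = p + (c0 + 1) := ⟨m - (c0 + 1), by omega⟩
    refine (win_left hp hmn _).dvd.trans (Dvd.dvd.mul_right ?_ _)
    have hd := Finset.dvd_prod_of_mem (fun k : Fin (m - 1) => FL K m n hmn k * FR K m n hmn k)
      (Finset.mem_univ (⟨c0, by omega⟩ : Fin (m - 1)))
    exact (dvd_mul_right _ _).trans hd
  by_cases h2 : c0 < n
  · obtain ⟨k, rfl⟩ : ∃ k, c0 = m - 1 + k := ⟨c0 - (m - 1), by omega⟩
    rw [win_mid hm (by omega)]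
    exact Dvd.dvd.mul_left
      (Finset.dvd_prod_of_mem (fun k : Fin (n - m + 1) => Matrix.det (Matrix.of fun (i j : Fin m) =>
        (MvPolynomial.X ((⟨i.val, i.isLt⟩ : Fin m), (⟨k.val + j.val, by omega⟩ : Fin n)) :
          MvPolynomial (Fin m × Fin n) K)))
        (Finset.mem_univ (⟨k, by omega⟩ : Fin (n - m + 1)))) _
  · obtain ⟨p, rfl⟩ : ∃ p, c0 = n + p - 1 := ⟨c0 + 1 - n, by omega⟩
    obtain ⟨k, hk⟩ : ∃ k, m = (k + 1) + p := ⟨m - 1 - p, by omega⟩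
    refine (win_right hk hmn (by omega) _).dvd.trans (Dvd.dvd.mul_right ?_ _)
    have hd := Finset.dvd_prod_of_mem (fun k : Fin (m - 1) => FL K m n hmn k * FR K m n hmn k)
      (Finset.mem_univ (⟨k, by omega⟩ : Fin (m - 1)))
    exact (dvd_mul_left _ _).trans hd

theorem isKnutson_of_dvd {K : Type*} [Field K] {m n : ℕ} {f g : MvPolynomial (Fin m × Fin n) K}
    (hf : f ≠ 0) (h : g ∣ f) : IsKnutson f (Ideal.span {g}) := by
  obtain ⟨u, rfl⟩ := h
  have hu : u ≠ 0 := right_ne_zero_of_mul hf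
  have : Ideal.span {g} = (Ideal.span {g * u}).colon (Ideal.span {u} : Ideal _) := by
    ext x
    rw [Ideal.mem_colon_span_singleton, Ideal.mem_span_singleton, Ideal.mem_span_singleton,
      mul_dvd_mul_iff_right hu]
  rw [this]
  exact IsKnutson.colon _ _ IsKnutson.base

theorem isKnutson_sum {K : Type*} [Field K] {m n : ℕ} {f : MvPolynomial (Fin m × Fin n) K}
    (g : ℕ → MvPolynomial (Fin m × Fin n) K) (b : ℕ)
    (h : ∀ a ≤ b, IsKnutson f (Ideal.span {g a})) :
    IsKnutson f (Ideal.span {x | ∃ a ≤ b, x = g a}) := by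
  induction b with
  | zero =>
    have : {x | ∃ a ≤ 0, x = g a} = {g 0} := by ext x; simp
    rw [this]
    exact h 0 le_rfl
  | succ b ih =>
    have : {x | ∃ a ≤ b + 1, x = g a} = {x | ∃ a ≤ b, x = g a} ∪ {g (b + 1)} := by
      ext x
      constructor
      · rintro ⟨a, ha, rfl⟩
        rcases Nat.lt_or_ge a (b + 1) with h1 | h1
        · exact Or.inl ⟨a, by omega, rfl⟩
        · obtain rfl : a = b + 1 := by omega
          exact Or.inr rfl
      · rintro (⟨a, ha, rfl⟩ | rfl)
        · exact ⟨a, by omega, rfl⟩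
        · exact ⟨b + 1, le_rfl, rfl⟩
    rw [this, Ideal.span_union]
    exact IsKnutson.add _ _ (ih fun a ha => h a (by omega)) (h _ le_rfl)

theorem main (K : Type*) [Field K] {m n q i0 d : ℕ} (hm : m = d + 1 + q)
    (h : i0 + (q + 1) ≤ n) (hm0 : 0 < m) (hmn : m < n) :
    IsKnutson (knutsonF K m n hm0 hmn) (PP K m h) := by
  obtain ⟨l, hl⟩ := exists_s K hm h hmn
  let J : Ideal (MvPolynomial (Fin m × Fin n) K) := Ideal.span {x | ∃ a ≤ d, x =
    (win (MvPolynomial.X : Fin m × Fin n → MvPolynomial (Fin m × Fin n) K) (i0 + q + a)).det}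
  have hJK : IsKnutson (knutsonF K m n hm0 hmn) J :=
    isKnutson_sum _ d fun a ha => isKnutson_of_dvd (knutsonF_ne_zero K m n hm0 hmn)
      (win_dvd K m n hm0 hmn _ (by omega))
  have hJQ : J ≤ QQ K m h := by
    refine Ideal.span_le.2 ?_
    rintro _ ⟨a, ha, rfl⟩
    exact win_mem_QQ K hm h a ha
  have hpr : (QQ K m h).IsPrime := QQ_prime K m h
  have : PP K m h = J.colon (Ideal.span {(Bhat d q i0 (by omega) l
      (MvPolynomial.X : Fin m × Fin n → MvPolynomial (Fin m × Fin n) K)).det ^ (q + 1)} : Ideal _) := by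
    ext x
    rw [Ideal.mem_colon_span_singleton]
    constructor
    · exact fun hx => s_mul_PP K hm h l J (fun a ha => Ideal.subset_span ⟨a, ha, rfl⟩) x hx
    · intro hx
      rw [← QQ_eq_PP]
      exact (hpr.mem_or_mem (hJQ hx)).resolve_right fun hs => hl (hpr.mem_of_pow_mem _ hs)
  rw [this]
  exact IsKnutson.colon _ _ hJK

end KnutsonAux

/-- For `1 ≤ t ≤ m` and every `i = 1, …, n - t + 1`, the ideal
`I_t(X_{[i, t+i-1]})` of `t`-minors on the `t` adjacent columns `i, …, t+i-1`
belongs to `C_f`. -/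
theorem determinantal_adjacent_cols_isKnutson (K : Type*) [Field K] (m n : ℕ)
    (hm : 0 < m) (hmn : m < n) (t : ℕ) (ht1 : 1 ≤ t) (htm : t ≤ m)
    (i : ℕ) (hi1 : 1 ≤ i) (hi2 : i ≤ n - t + 1) :
    IsKnutson (knutsonF K m n hm hmn) (genMinors K m n t 1 m i (t + i - 1)) := by
  obtain ⟨q, rfl⟩ : ∃ q, t = q + 1 := ⟨t - 1, by omega⟩
  obtain ⟨i0, rfl⟩ : ∃ i0, i = i0 + 1 := ⟨i - 1, by omega⟩
  have h : i0 + (q + 1) ≤ n := by omega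
  rw [KnutsonAux.genMinors_eq K m h]
  exact KnutsonAux.main K (d := m - (q + 1)) (by omega) h hm hmn
end
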